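/- arXiv:2501.18234 — 3 statements merged into one kernel-verified Lean document; each statement's English description precedes it below -/
import Mathlib

section
/- Unboundedness below of the Moser energy over non-radial functions for β>2 (Example 3.4). Let β > 2 and let V : ℝ² → ℝ be continuous and nonnegative on the closed unit ball, with V(x₀) > 0 for some x₀ in the open unit ball D(0,1). Then for every M ∈ ℝ there exists a Lipschitz function φ : ℝ² → ℝ vanishing outside D(0,1) such that ∫_{D(0,1)} V·e^{φ} dx > 0 and (1/2)·∫_{D(0,1)} ‖Dφ(x)‖² dx - 4πβ·log(∫_{D(0,1)} V·e^{φ} dx) ≤ M, where Dφ(x) denotes the (Fréchet) derivative of φ at x, which exists for a.e. x by Rademacher's theorem (with the junk value 0 elsewhere). -/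
open MeasureTheory Real Filter Bornology Metric
open scoped NNReal

noncomputable section

abbrev R2 : Type := EuclideanSpace ℝ (Fin 2)

/-- The Laplacian of `f : ℝ² → ℝ`, via the second iterated Fréchet derivative. -/
def lap (f : R2 → ℝ) (x : R2) : ℝ :=
  ∑ i : Fin 2, iteratedFDeriv ℝ 2 f x ![EuclideanSpace.single i 1, EuclideanSpace.single i 1]

/-- `ψ` is a weak (distributional) solution of `-Δψ = g` on `ℝ²`:
for every smooth compactly supported test function `φ`, `∫ ψ·Δφ = -∫ g·φ`. -/
def IsWeakSol (ψ g : R2 → ℝ) : Prop :=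
  ∀ φ : R2 → ℝ, ContDiff ℝ (⊤ : ℕ∞) φ → HasCompactSupport φ →
    ∫ x : R2, ψ x * lap φ x = -∫ x : R2, g x * φ x

/-- `f` is radially symmetric. -/
def RadSym (f : R2 → ℝ) : Prop := ∀ x y : R2, ‖x‖ = ‖y‖ → f x = f y

theorem abs_log_sub_log_le {r s t : ℝ} (hr : 0 < r) (hs : r ≤ s) (ht : r ≤ t) :
    |log s - log t| ≤ |s - t| / r := by
  have key : ∀ s t : ℝ, r ≤ s → r ≤ t → log s - log t ≤ |s - t| / r := by
    intro s t hs ht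
    have hs0 := hr.trans_le hs
    have ht0 := hr.trans_le ht
    rw [← log_div hs0.ne' ht0.ne']
    calc log (s / t) ≤ s / t - 1 := log_le_sub_one_of_pos (by positivity)
      _ = (s - t) / t := by field_simp
      _ ≤ |s - t| / t := by gcongr; exact le_abs_self _
      _ ≤ |s - t| / r := by gcongr
  rw [abs_le]
  have h1 := key s t hs ht
  have h2 := key t s ht hs
  rw [abs_sub_comm] at h2
  exact ⟨by linarith, h1⟩

/-- The logarithmic profile `a * log (R / ‖x - x₀‖)`, truncated to be constant on the ball of
radius `ε` around `x₀` and to vanish outside the ball of radius `R`. -/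
def truncLog (x₀ : R2) (a R ε : ℝ) (x : R2) : ℝ :=
  a * (log R - log (max ε (min R ‖x - x₀‖)))

theorem abs_truncLog_sub_le {x₀ : R2} {a R ε r : ℝ} (ha : 0 ≤ a) (hr : 0 < r) {x y : R2}
    (hx : r ≤ max ε (min R ‖x - x₀‖)) (hy : r ≤ max ε (min R ‖y - x₀‖)) :
    |truncLog x₀ a R ε x - truncLog x₀ a R ε y| ≤ a / r * ‖x - y‖ := by
  have h1 := abs_log_sub_log_le hr hx hy
  have h2 : |max ε (min R ‖x - x₀‖) - max ε (min R ‖y - x₀‖)| ≤ ‖x - y‖ := by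
    calc |max ε (min R ‖x - x₀‖) - max ε (min R ‖y - x₀‖)|
        ≤ |min R ‖x - x₀‖ - min R ‖y - x₀‖| := by
          simpa using abs_max_sub_max_le_max ε (min R ‖x - x₀‖) ε (min R ‖y - x₀‖)
      _ ≤ |‖x - x₀‖ - ‖y - x₀‖| := by
        simpa using abs_min_sub_min_le_max R ‖x - x₀‖ R ‖y - x₀‖
      _ ≤ ‖(x - x₀) - (y - x₀)‖ := abs_norm_sub_norm_le _ _
      _ = ‖x - y‖ := by simp
  have h3 : truncLog x₀ a R ε x - truncLog x₀ a R ε y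
      = -(a * (log (max ε (min R ‖x - x₀‖)) - log (max ε (min R ‖y - x₀‖)))) := by
    simp only [truncLog]; ring
  rw [h3, abs_neg, abs_mul, abs_of_nonneg ha]
  calc _ ≤ a * (‖x - y‖ / r) := by gcongr; exact h1.trans (by gcongr)
    _ = _ := by ring

theorem lipschitzWith_truncLog (x₀ : R2) {a ε : ℝ} (R : ℝ) (ha : 0 ≤ a) (hε : 0 < ε) :
    LipschitzWith (a / ε).toNNReal (truncLog x₀ a R ε) := by
  refine LipschitzWith.of_dist_le_mul fun x y => ?_
  rw [dist_eq_norm, dist_eq_norm, norm_eq_abs, coe_toNNReal _ (by positivity)]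
  exact abs_truncLog_sub_le ha hε (le_max_left _ _) (le_max_left _ _)

theorem truncLog_of_le {x₀ x : R2} {R ε : ℝ} (a : ℝ) (hεR : ε ≤ R) (h : R ≤ ‖x - x₀‖) :
    truncLog x₀ a R ε x = 0 := by
  simp [truncLog, min_eq_left h, max_eq_right hεR]

theorem truncLog_of_norm_le {x₀ x : R2} {ε : ℝ} (a R : ℝ) (h : ‖x - x₀‖ ≤ ε) :
    truncLog x₀ a R ε x = a * (log R - log ε) := by
  rw [truncLog, max_eq_left ((min_le_right _ _).trans h)]

theorem norm_fderiv_truncLog_le {a R ε : ℝ} (ha : 0 < a) (hε : 0 < ε) (hεR : ε ≤ R)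
    (x₀ x : R2) :
    ‖fderiv ℝ (truncLog x₀ a R ε) x‖ ≤
      (Set.Icc ε R).indicator (fun y => a / y) ‖x - x₀‖ := by
  have hcont : Continuous fun y : R2 => ‖y - x₀‖ := by fun_prop
  by_cases h : ‖x - x₀‖ ∈ Set.Icc ε R
  · rw [Set.indicator_of_mem h]
    have hρ : 0 < ‖x - x₀‖ := hε.trans_le h.1
    have key : ∀ r, 0 < r → r < ‖x - x₀‖ → ‖fderiv ℝ (truncLog x₀ a R ε) x‖ ≤ a / r := by
      intro r hr hrx
      refine norm_fderiv_le_of_lip' ℝ (by positivity) ?_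
      filter_upwards [hcont.continuousAt.eventually (lt_mem_nhds hrx)] with y hy
      have hrR : r ≤ R := hrx.le.trans h.2
      exact abs_truncLog_sub_le ha.le hr
        ((le_min hrR hy.le).trans (le_max_right _ _)) ((le_min hrR hrx.le).trans (le_max_right _ _))
    by_contra! hN
    set N := ‖fderiv ℝ (truncLog x₀ a R ε) x‖
    have hN0 : 0 < N := lt_trans (by positivity) hN
    obtain ⟨r, hr1, hr2⟩ := exists_between ((div_lt_comm₀ hρ hN0).1 hN)
    have hr0 : 0 < r := lt_trans (by positivity) hr1
    exact absurd (key r hr0 hr2) (not_le.2 ((div_lt_comm₀ hN0 hr0).1 hr1))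
  · rw [Set.indicator_of_notMem h]
    have : ∃ c : ℝ, truncLog x₀ a R ε =ᶠ[nhds x] fun _ => c := by
      rcases lt_or_ge ‖x - x₀‖ ε with h1 | h1
      · refine ⟨a * (log R - log ε), ?_⟩
        filter_upwards [hcont.continuousAt.eventually (gt_mem_nhds h1)] with y hy
        exact truncLog_of_norm_le a R hy.le
      · have h2 : R < ‖x - x₀‖ := by
          by_contra! h2
          exact h ⟨h1, h2⟩
        refine ⟨0, ?_⟩
        filter_upwards [hcont.continuousAt.eventually (lt_mem_nhds h2)] with y hy
        exact truncLog_of_le a hεR hy.le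
    obtain ⟨c, hc⟩ := this
    rw [hc.fderiv_eq]
    simp

theorem integral_sq_norm_fderiv_truncLog_le {a R ε : ℝ} (ha : 0 < a) (hε : 0 < ε) (hεR : ε ≤ R)
    (x₀ : R2) (s : Set R2) :
    ∫ x in s, ‖fderiv ℝ (truncLog x₀ a R ε) x‖ ^ 2 ≤ 2 * π * a ^ 2 * log (R / ε) := by
  set g : ℝ → ℝ := (Set.Icc ε R).indicator (fun y => a ^ 2 / y ^ 2) with hg
  have hfin : Module.finrank ℝ R2 = 2 := by simp
  have hmul : (fun y : ℝ => y ^ (Module.finrank ℝ R2 - 1) • g y)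
      = (Set.Icc ε R).indicator (fun y => a ^ 2 * y⁻¹) := by
    ext y
    rw [hfin, hg]
    by_cases hy : y ∈ Set.Icc ε R
    · have : y ≠ 0 := (hε.trans_le hy.1).ne'
      simp only [Set.indicator_of_mem hy, smul_eq_mul]
      field_simp
      norm_num
    · simp [Set.indicator_of_notMem hy]
  have hcont : ContinuousOn (fun y : ℝ => a ^ 2 * y⁻¹) (Set.Icc ε R) :=
    continuousOn_const.mul (continuousOn_inv₀.mono fun y hy => (hε.trans_le hy.1).ne')
  have hint0 : Integrable fun x : R2 => g ‖x‖ := by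
    rw [integrable_fun_norm_addHaar, hmul]
    exact ((integrable_indicator_iff measurableSet_Icc).2
      (hcont.integrableOn_compact isCompact_Icc)).integrableOn
  have hint : Integrable fun x : R2 => g ‖x - x₀‖ := hint0.comp_sub_right x₀
  have hle : ∀ x : R2, ‖fderiv ℝ (truncLog x₀ a R ε) x‖ ^ 2 ≤ g ‖x - x₀‖ := by
    intro x
    have h := norm_fderiv_truncLog_le ha hε hεR x₀ x
    calc _ ≤ ((Set.Icc ε R).indicator (fun y => a / y) ‖x - x₀‖) ^ 2 := by gcongr
      _ = g ‖x - x₀‖ := by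
        by_cases hy : ‖x - x₀‖ ∈ Set.Icc ε R
        · simp [hg, Set.indicator_of_mem hy, div_pow]
        · simp [hg, Set.indicator_of_notMem hy]
  have hsub : Set.Icc ε R ⊆ Set.Ioi 0 := fun y hy => hε.trans_le hy.1
  have hvol : (volume : Measure R2).real (ball 0 1) = π := by
    simp [measureReal_def, EuclideanSpace.volume_ball_fin_two, pi_nonneg]
  calc ∫ x in s, ‖fderiv ℝ (truncLog x₀ a R ε) x‖ ^ 2
      ≤ ∫ x in s, g ‖x - x₀‖ :=
        integral_mono_of_nonneg (.of_forall fun x => by positivity) hint.integrableOn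
          (.of_forall hle)
    _ ≤ ∫ x, g ‖x - x₀‖ :=
        setIntegral_le_integral hint (.of_forall fun x => (sq_nonneg _).trans (hle x))
    _ = ∫ x : R2, g ‖x‖ := integral_sub_right_eq_self (fun x : R2 => g ‖x‖) x₀
    _ = 2 * π * a ^ 2 * log (R / ε) := by
      rw [integral_fun_norm_addHaar, hmul, hfin, hvol, setIntegral_indicator measurableSet_Icc,
        Set.inter_eq_right.2 hsub, integral_Icc_eq_integral_Ioc,
        ← intervalIntegral.integral_of_le hεR, intervalIntegral.integral_const_mul,
        integral_inv_of_pos hε (hε.trans_le hεR)]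
      simp
      ring

theorem le_setIntegral_mul_exp_truncLog {V : R2 → ℝ} {s : Set R2} (hs : MeasurableSet s)
    (hV0 : ∀ x ∈ s, 0 ≤ V x) {x₀ : R2} {a R ε c : ℝ} (hε : 0 < ε) (hsub : ball x₀ ε ⊆ s)
    (hint : IntegrableOn (fun x => V x * Real.exp (truncLog x₀ a R ε x)) s)
    (hc : ∀ x ∈ ball x₀ ε, c ≤ V x) :
    c * Real.exp (a * (log R - log ε)) * (π * ε ^ 2) ≤
      ∫ x in s, V x * Real.exp (truncLog x₀ a R ε x) := by
  have hvol : (volume : Measure R2).real (ball x₀ ε) = π * ε ^ 2 := by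
    simp [measureReal_def, EuclideanSpace.volume_ball_fin_two, pi_nonneg, hε.le, mul_comm]
  calc c * Real.exp (a * (log R - log ε)) * (π * ε ^ 2)
      = ∫ _ in ball x₀ ε, c * Real.exp (a * (log R - log ε)) := by
        rw [setIntegral_const, hvol, smul_eq_mul, mul_comm]
    _ ≤ ∫ x in ball x₀ ε, V x * Real.exp (truncLog x₀ a R ε x) := by
        refine setIntegral_mono_on (integrableOn_const measure_ball_lt_top.ne)
          (hint.mono_set hsub) measurableSet_ball fun x hx => ?_
        rw [truncLog_of_norm_le a R (mem_ball_iff_norm.1 hx).le]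
        gcongr
        exact hc x hx
    _ ≤ ∫ x in s, V x * Real.exp (truncLog x₀ a R ε x) := by
        refine setIntegral_mono_set hint ?_ (LE.le.eventuallyLE hsub)
        filter_upwards [ae_restrict_mem hs] with x hx
        exact mul_nonneg (hV0 x hx) (Real.exp_nonneg _)

/-- Example 3.4: for β > 2 and V positive somewhere, the Moser energy functional
is unbounded below over (non-radial) compactly supported Lipschitz functions. -/
theorem moser_energy_unbounded (β : ℝ) (hβ : 2 < β)
    (V : R2 → ℝ) (hVc : ContinuousOn V (closedBall (0:R2) 1))
    (hV0 : ∀ x ∈ closedBall (0:R2) 1, 0 ≤ V x)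
    (x₀ : R2) (hx₀ : x₀ ∈ ball (0:R2) 1) (hVx₀ : 0 < V x₀) :
    ∀ M : ℝ, ∃ φ : R2 → ℝ, (∃ L : ℝ≥0, LipschitzWith L φ) ∧
      (∀ x : R2, x ∉ ball (0:R2) 1 → φ x = 0) ∧
      0 < (∫ x in ball (0:R2) 1, V x * Real.exp (φ x)) ∧
      (1/2) * (∫ x in ball (0:R2) 1, ‖fderiv ℝ φ x‖ ^ 2)
        - 4 * π * β * Real.log (∫ x in ball (0:R2) 1, V x * Real.exp (φ x))
        ≤ M := by
  intro M
  have hβ0 : 0 < β := by linarith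
  have hVat : ContinuousAt V x₀ :=
    hVc.continuousAt (mem_of_superset (isOpen_ball.mem_nhds hx₀) ball_subset_closedBall)
  obtain ⟨R, hR, hRsub⟩ := Metric.mem_nhds_iff.1 (inter_mem (isOpen_ball.mem_nhds hx₀)
    (hVat.eventually (lt_mem_nhds (half_lt_self hVx₀))))
  set c := V x₀ / 2 with hc
  have hc0 : 0 < c := half_pos hVx₀
  set C := log (c * π * R ^ 2) with hC
  obtain ⟨T, hT0, hT⟩ : ∃ T : ℝ, 0 ≤ T ∧ -M - 4 * π * β * C ≤ 4 * π * β * (β - 2) * T := by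
    have hk : 0 < 4 * π * β * (β - 2) := mul_pos (by positivity) (by linarith)
    refine ⟨max 0 ((-M - 4 * π * β * C) / (4 * π * β * (β - 2))), le_max_left _ _, ?_⟩
    rw [← div_le_iff₀' hk]
    exact le_max_right _ _
  set ε := R * Real.exp (-T) with hε
  have hε0 : 0 < ε := by positivity
  have hεR : ε ≤ R := mul_le_of_le_one_right hR.le (Real.exp_le_one_iff.2 (by linarith))
  have hlog : log R - log ε = T := by
    rw [hε, log_mul hR.ne' (Real.exp_pos _).ne', Real.log_exp]
    ring
  have hLip := lipschitzWith_truncLog x₀ R (by positivity : 0 ≤ 2 * β) hε0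
  have hint : IntegrableOn (fun x => V x * Real.exp (truncLog x₀ (2 * β) R ε x))
      (ball (0 : R2) 1) :=
    ((hVc.mul (Real.continuous_exp.comp hLip.continuous).continuousOn).integrableOn_compact
      (isCompact_closedBall _ _)).mono_set ball_subset_closedBall
  have hlow := le_setIntegral_mul_exp_truncLog measurableSet_ball
    (fun x hx => hV0 x (ball_subset_closedBall hx)) hε0
    (fun x hx => (hRsub (ball_subset_ball hεR hx)).1) hint
    (c := c) (fun x hx => (hRsub (ball_subset_ball hεR hx)).2.le)
  have hgrad := integral_sq_norm_fderiv_truncLog_le (by positivity : 0 < 2 * β) hε0 hεR x₀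
    (ball (0 : R2) 1)
  rw [log_div hR.ne' hε0.ne', hlog] at hgrad
  have heq : c * Real.exp (2 * β * (log R - log ε)) * (π * ε ^ 2)
      = c * π * R ^ 2 * Real.exp ((2 * β - 2) * T) := by
    rw [hlog, hε, mul_pow, ← Real.exp_nat_mul,
      show (2 * β - 2) * T = 2 * β * T + (2 : ℕ) * -T by push_cast; ring, Real.exp_add]
    ring
  rw [heq] at hlow
  have hpos : 0 < c * π * R ^ 2 * Real.exp ((2 * β - 2) * T) := by positivity
  have hlogI := Real.log_le_log hpos hlow
  rw [log_mul (by positivity) (Real.exp_pos _).ne', Real.log_exp, ← hC] at hlogI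
  refine ⟨truncLog x₀ (2 * β) R ε, ⟨_, hLip⟩, fun x hx => ?_, hpos.trans_le hlow, ?_⟩
  · refine truncLog_of_le _ hεR ?_
    by_contra! h
    exact hx (hRsub (mem_ball_iff_norm.2 h)).1
  · have := mul_le_mul_of_nonneg_left hlogI (by positivity : 0 ≤ 4 * π * β)
    linarith
end
end

section
/- Stability of solutions under perturbations for β<0 (Corollary 5.1). Let β < 0 and α ∈ (0,1]. Let V_n : ℝ² → ℝ (n ∈ ℕ) be nonnegative, α-Hölder continuous functions converging locally uniformly to V : ℝ² → ℝ, and let ψ_n : ℝ² → ℝ be twice continuously differentiable functions with -Δψ_n(x) = 4πβ·V_n(x)·e^{ψ_n(x)} for every x ∈ ℝ² and ψ_n(x)/log‖x‖ → -2β as ‖x‖ → ∞, for every n. Assume there exist α-Hölder continuous W₁, W₂ : ℝ² → ℝ and twice continuously differentiable φ₁, φ₂ : ℝ² → ℝ such that 0 ≤ W₁(x) ≤ V_n(x) ≤ W₂(x) for every x and n, -Δφᵢ(x) = 4πβ·Wᵢ(x)·e^{φᵢ(x)} for every x (i = 1,2), and φᵢ(x)/log‖x‖ → -2β as ‖x‖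 → ∞ (i = 1,2). Then there exists a continuous ψ : ℝ² → ℝ such that ψ_n → ψ locally uniformly, ψ is a weak solution of -Δψ = 4πβ·V·e^{ψ} on ℝ², and ψ(x)/log‖x‖ → -2β as ‖x‖ → ∞. -/
open MeasureTheory Real Filter Bornology Metric
open scoped NNReal

noncomputable section

open scoped Topology

lemma lap_eq_laplacian (f : R2 → ℝ) : lap f = Laplacian.laplacian f := by
  rw [InnerProductSpace.laplacian_eq_iteratedFDeriv_orthonormalBasis f
    (EuclideanSpace.basisFun (Fin 2) ℝ)]
  ext x
  simp [lap]

lemma lap_add {f g : R2 → ℝ} (hf : ContDiff ℝ 2 f) (hg : ContDiff ℝ 2 g) (x : R2) :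
    lap (fun y => f y + g y) x = lap f x + lap g x := by
  simp only [lap_eq_laplacian]
  exact hf.contDiffAt.laplacian_add hg.contDiffAt

lemma lap_sub {f g : R2 → ℝ} (hf : ContDiff ℝ 2 f) (hg : ContDiff ℝ 2 g) (x : R2) :
    lap (fun y => f y - g y) x = lap f x - lap g x := by
  simp only [lap_eq_laplacian]
  exact hf.contDiffAt.laplacian_sub hg.contDiffAt

lemma lap_const_mul {f : R2 → ℝ} (hf : ContDiff ℝ 2 f) (a : ℝ) (x : R2) :
    lap (fun y => a * f y) x = a * lap f x := by
  simp only [lap_eq_laplacian]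
  exact InnerProductSpace.laplacian_smul a hf.contDiffAt

lemma lap_eq_sum_fderiv {f : R2 → ℝ} (hf : ContDiff ℝ 2 f) (x : R2) :
    lap f x = ∑ i : Fin 2, fderiv ℝ (fun y => fderiv ℝ f y (EuclideanSpace.single i 1)) x
      (EuclideanSpace.single i 1) := by
  refine Finset.sum_congr rfl fun i _ => ?_
  have hd : DifferentiableAt ℝ (fderiv ℝ f) x :=
    (hf.fderiv_right (m := 1) (by norm_num)).differentiable (by norm_num) x
  rw [iteratedFDeriv_two_apply, fderiv_clm_apply hd (differentiableAt_const _)]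
  simp

lemma continuous_lap {f : R2 → ℝ} (hf : ContDiff ℝ 2 f) : Continuous (lap f) := by
  unfold lap
  refine continuous_finsetSum _ fun i _ => ?_
  exact (hf.continuous_iteratedFDeriv le_rfl).eval_const _

lemma deriv_deriv_nonpos_of_isLocalMax {g : ℝ → ℝ} {t : ℝ} (hg : ContinuousAt g t)
    (hmax : IsLocalMax g t) : deriv (deriv g) t ≤ 0 := by
  by_contra! hpos
  have hmin := isLocalMin_of_deriv_deriv_pos hpos hmax.deriv_eq_zero hg
  have hconst : g =ᶠ[𝓝 t] fun _ => g t := by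
    filter_upwards [hmax, hmin] with s h1 h2 using le_antisymm h1 h2
  have h2 := hconst.deriv.deriv.eq_of_nhds
  simp at h2
  linarith

lemma lap_nonpos_of_isLocalMax {f : R2 → ℝ} (hf : ContDiff ℝ 2 f) {x : R2}
    (hmax : IsLocalMax f x) : lap f x ≤ 0 := by
  rw [lap_eq_sum_fderiv hf]
  refine Finset.sum_nonpos fun i _ => ?_
  set e : R2 := EuclideanSpace.single i 1
  have hline : ∀ s : ℝ, HasDerivAt (fun t : ℝ => x + t • e) e s := fun s => by
    simpa using ((hasDerivAt_id s).smul_const e).const_add x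
  have h1 : deriv (fun t : ℝ => f (x + t • e)) = fun t => fderiv ℝ f (x + t • e) e := by
    ext t
    exact ((hf.differentiable (by norm_num) _).hasFDerivAt.comp_hasDerivAt t (hline t)).deriv
  have hd : Differentiable ℝ (fun y => fderiv ℝ f y e) :=
    ((hf.fderiv_right (m := 1) (by norm_num)).clm_apply contDiff_const).differentiable
      (by norm_num)
  have h2 : deriv (fun t : ℝ => fderiv ℝ f (x + t • e) e) 0
      = fderiv ℝ (fun y => fderiv ℝ f y e) x e := by
    have := ((hd (x + (0:ℝ) • e)).hasFDerivAt.comp_hasDerivAt 0 (hline 0)).deriv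
    simpa [Function.comp_def] using this
  have hc : Continuous (fun t : ℝ => x + t • e) := by fun_prop
  have hm : IsLocalMax (fun t : ℝ => f (x + t • e)) 0 := by
    have ht : Tendsto (fun t : ℝ => x + t • e) (𝓝 0) (𝓝 x) := by
      simpa using hc.tendsto 0
    simpa [IsLocalMax, IsMaxFilter] using ht.eventually hmax
  have h3 := deriv_deriv_nonpos_of_isLocalMax (g := fun t : ℝ => f (x + t • e))
    ((hf.continuous.comp hc).continuousAt (x := 0)) hm
  rwa [h1, h2] at h3

/-- Green identity against a test function. -/
lemma integral_mul_lap_eq {u φ : R2 → ℝ} (hu : ContDiff ℝ 2 u) (hφ : ContDiff ℝ 2 φ)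
    (hc : HasCompactSupport φ) : ∫ x, u x * lap φ x = ∫ x, lap u x * φ x := by
  simp only [lap_eq_sum_fderiv hu, lap_eq_sum_fderiv hφ, Finset.mul_sum, Finset.sum_mul]
  have hpart : ∀ {f : R2 → ℝ}, ContDiff ℝ 2 f → ∀ v : R2,
      ContDiff ℝ 1 (fun y => fderiv ℝ f y v) := fun hf v =>
    (hf.fderiv_right (m := 1) (by norm_num)).clm_apply contDiff_const
  have hpart2 : ∀ {f : R2 → ℝ}, ContDiff ℝ 2 f → ∀ v : R2,
      Continuous (fun x => fderiv ℝ (fun y => fderiv ℝ f y v) x v) := fun hf v =>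
    ((hpart hf v).continuous_fderiv (by norm_num)).clm_apply continuous_const
  have hc1 : ∀ v : R2, HasCompactSupport (fun y => fderiv ℝ φ y v) := fun v => hc.fderiv_apply ℝ v
  have hc2 : ∀ v : R2, HasCompactSupport (fun x => fderiv ℝ (fun y => fderiv ℝ φ y v) x v) :=
    fun v => (hc1 v).fderiv_apply ℝ v
  have int : ∀ {f g : R2 → ℝ}, Continuous f → Continuous g → HasCompactSupport g →
      Integrable (fun x => f x * g x) := fun hf hg hcg =>
    (hf.mul hg).integrable_of_hasCompactSupport hcg.mul_left
  rw [integral_finsetSum _ fun i _ => int hu.continuous (hpart2 hφ _) (hc2 _),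
    integral_finsetSum _ fun i _ => int (hpart2 hu _) hφ.continuous hc]
  refine Finset.sum_congr rfl fun i _ => ?_
  set e : R2 := EuclideanSpace.single i 1
  rw [integral_mul_fderiv_eq_neg_fderiv_mul_of_integrable
      (int (hpart hu e).continuous (hpart hφ e).continuous (hc1 e))
      (int hu.continuous (hpart2 hφ e) (hc2 e))
      (int hu.continuous (hpart hφ e).continuous (hc1 e))
      (fun x _ => hu.differentiable (by norm_num) x)
      (fun x _ => (hpart hφ e).differentiable (by norm_num) x),
    integral_mul_fderiv_eq_neg_fderiv_mul_of_integrable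
      (int (hpart2 hu e) hφ.continuous hc)
      (int (hpart hu e).continuous (hpart hφ e).continuous (hc1 e))
      (int (hpart hu e).continuous hφ.continuous hc)
      (fun x _ => (hpart hu e).differentiable (by norm_num) x)
      (fun x _ => hφ.differentiable (by norm_num) x), neg_neg]

lemma lap_radial {F F₁ F₂ : ℝ → ℝ} (p : R2)
    (hF : ∀ t, 0 ≤ t → HasDerivAt F (F₁ t) t) (hF₁ : ∀ t, 0 ≤ t → HasDerivAt F₁ (F₂ t) t)
    (hC : ContDiff ℝ 2 fun x : R2 => F (‖x - p‖ ^ 2)) (x : R2) :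
    lap (fun x => F (‖x - p‖ ^ 2)) x
      = 4 * ‖x - p‖ ^ 2 * F₂ (‖x - p‖ ^ 2) + 4 * F₁ (‖x - p‖ ^ 2) := by
  have hn : ∀ y : R2, HasFDerivAt (fun y : R2 => ‖y - p‖ ^ 2) (2 • innerSL ℝ (y - p)) y :=
    fun y => by
      simpa using ((hasFDerivAt_id y).sub_const p).norm_sq
  have h1 : ∀ v : R2, (fun y => fderiv ℝ (fun x => F (‖x - p‖ ^ 2)) y v)
      = fun y => F₁ (‖y - p‖ ^ 2) * (2 * inner ℝ (y - p) v) := fun v => by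
    ext y
    have hd : HasFDerivAt (fun x => F (‖x - p‖ ^ 2)) _ y :=
      (hF _ (sq_nonneg _)).comp_hasFDerivAt y (hn y)
    rw [hd.fderiv]
    simp [inner_sub_left]
  have h2 : ∀ v : R2, fderiv ℝ (fun y => F₁ (‖y - p‖ ^ 2) * (2 * inner ℝ (y - p) v)) x v
      = F₂ (‖x - p‖ ^ 2) * (2 * inner ℝ (x - p) v) ^ 2 + F₁ (‖x - p‖ ^ 2) * (2 * ‖v‖ ^ 2) :=
    fun v => by
      have hi : HasFDerivAt (fun y : R2 => 2 * inner ℝ (y - p) v)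
          ((2:ℝ) • innerSL ℝ v) x := by
        have := (((innerSL ℝ v).hasFDerivAt (x := x - p)).comp x
          ((hasFDerivAt_id x).sub_const p)).const_mul (2:ℝ)
        simpa [Function.comp_def, real_inner_comm] using this
      have hd : HasFDerivAt (fun y => F₁ (‖y - p‖ ^ 2) * (2 * inner ℝ (y - p) v)) _ x :=
        ((hF₁ _ (sq_nonneg _)).comp_hasFDerivAt x (hn x)).mul hi
      rw [hd.fderiv]
      simp [inner_sub_left]
      ring
  rw [lap_eq_sum_fderiv hC]
  simp only [h1, h2]
  have hs : ‖x - p‖ ^ 2 = (x - p) 0 ^ 2 + (x - p) 1 ^ 2 := by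
    rw [EuclideanSpace.norm_sq_eq]
    simp
  simp only [Fin.sum_univ_two, EuclideanSpace.inner_single_right]
  generalize F₁ (‖x - p‖ ^ 2) = a
  generalize F₂ (‖x - p‖ ^ 2) = b
  rw [hs]
  simp
  ring

/-- If `q ≥ 0` is continuous and positive somewhere, then the operator `Δ - q` has a positive
supersolution on the plane which grows at least logarithmically. -/
lemma exists_log_supersolution {q : R2 → ℝ} (hq : Continuous q) (hq0 : ∀ x, 0 ≤ q x) {p : R2}
    (hp : 0 < q p) :
    ∃ h : R2 → ℝ, ContDiff ℝ 2 h ∧ (∀ x, 0 < h x) ∧ (∀ x, lap h x ≤ q x * h x) ∧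
      ∀ᶠ x in cobounded R2, Real.log ‖x‖ ≤ h x := by
  obtain ⟨r, hr, hrq⟩ : ∃ r > 0, ∀ x, dist x p < r → q p / 2 < q x :=
    Metric.eventually_nhds_iff.1 (hq.continuousAt.eventually (lt_mem_nhds (half_lt_self hp)))
  set m := q p / 2
  have hm : 0 < m := half_pos hp
  set b := r ^ 2 / 4
  have hb : 0 < b := by positivity
  set A := 4 + |Real.log b| + 16 / (b * m)
  set F : ℝ → ℝ := fun t => A + Real.log (b + t) - 3 * b / (b + t)
  set h : R2 → ℝ := fun x => F (‖x - p‖ ^ 2)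
  have hpos : ∀ x : R2, 0 < b + ‖x - p‖ ^ 2 := fun x => by positivity
  have hC : ContDiff ℝ 2 h := by
    have h1 : ContDiff ℝ 2 fun x : R2 => b + ‖x - p‖ ^ 2 :=
      contDiff_const.add ((contDiff_id.sub contDiff_const).norm_sq ℝ)
    exact (contDiff_const.add (h1.log fun x => (hpos x).ne')).sub
      (contDiff_const.div h1 fun x => (hpos x).ne')
  have hlap : ∀ x, lap h x = 8 * b * (2 * b - ‖x - p‖ ^ 2) / (b + ‖x - p‖ ^ 2) ^ 3 := by
    intro x
    have hadd : ∀ t : ℝ, HasDerivAt (fun t => b + t) 1 t := fun t => (hasDerivAt_id t).const_add b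
    rw [lap_radial (F := F) (F₁ := fun t => 1 / (b + t) + 3 * b / (b + t) ^ 2)
      (F₂ := fun t => -1 / (b + t) ^ 2 - 6 * b / (b + t) ^ 3) p ?_ ?_ hC]
    · have := (hpos x).ne'
      field_simp
      ring
    · intro t ht
      have hne : b + t ≠ 0 := by positivity
      refine ((((hadd t).log hne).const_add A).sub
        ((hasDerivAt_const t (3 * b)).div (hadd t) hne)).congr_deriv ?_
      field_simp
      ring
    · intro t ht
      have hne : b + t ≠ 0 := by positivity
      refine (((hasDerivAt_const t (1 : ℝ)).div (hadd t) hne).add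
        ((hasDerivAt_const t (3 * b)).div ((hadd t).pow 2) (pow_ne_zero 2 hne))).congr_deriv ?_
      simp only [Pi.pow_apply]
      field_simp
      ring
  have hfrac : ∀ x : R2, 3 * b / (b + ‖x - p‖ ^ 2) ≤ 3 := fun x => by
    rw [div_le_iff₀ (hpos x)]
    nlinarith [sq_nonneg ‖x - p‖]
  have h16 : 0 < 16 / (b * m) := by positivity
  have hlow : ∀ x, 1 + 16 / (b * m) ≤ h x := by
    intro x
    have h1 : Real.log b ≤ Real.log (b + ‖x - p‖ ^ 2) :=
      Real.log_le_log hb (by nlinarith [sq_nonneg ‖x - p‖])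
    have h2 := neg_abs_le (Real.log b)
    have h3 := hfrac x
    simp only [h, F, A]
    linarith
  refine ⟨h, hC, fun x => by linarith [hlow x], fun x => ?_, ?_⟩
  · rw [hlap]
    have hh : 0 < h x := by linarith [hlow x]
    rcases le_or_gt (2 * b) (‖x - p‖ ^ 2) with hx | hx
    · refine le_trans ?_ (mul_nonneg (hq0 x) hh.le)
      exact div_nonpos_of_nonpos_of_nonneg
        (mul_nonpos_of_nonneg_of_nonpos (by positivity) (by linarith)) (by positivity)
    · have hqx : m < q x := hrq x (by
        rw [dist_eq_norm]
        refine lt_of_pow_lt_pow_left₀ 2 hr.le ?_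
        simp only [b] at hx
        nlinarith)
      calc 8 * b * (2 * b - ‖x - p‖ ^ 2) / (b + ‖x - p‖ ^ 2) ^ 3
          ≤ 8 * b * (2 * b) / b ^ 3 := by
            gcongr
            · nlinarith [sq_nonneg ‖x - p‖]
            · nlinarith [sq_nonneg ‖x - p‖]
        _ = m * (16 / (b * m)) := by field_simp; norm_num
        _ ≤ q x * h x :=
            mul_le_mul hqx.le (by linarith [hlow x]) h16.le (hq0 x)
  · have hev : ∀ᶠ x : R2 in cobounded R2, 2 * ‖p‖ + 4 ≤ ‖x‖ :=
      tendsto_norm_cobounded_atTop.eventually_ge_atTop _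
    filter_upwards [hev] with x hx
    have hp0 := norm_nonneg p
    have h1 : ‖x‖ / 2 ≤ ‖x - p‖ := by linarith [norm_sub_norm_le x p]
    have h2 : ‖x‖ ≤ b + ‖x - p‖ ^ 2 := by nlinarith
    have h3 := Real.log_le_log (by linarith) h2
    have h4 := hfrac x
    have h5 := abs_nonneg (Real.log b)
    simp only [h, F, A]
    linarith

/-- Maximum principle on a ball for almost-subsolutions of `Δ - q`, measured against a positive
supersolution `h`. -/
lemma le_of_subsolution_on_ball {q w h : R2 → ℝ} (hw : ContDiff ℝ 2 w) (hh : ContDiff ℝ 2 h)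
    (hq0 : ∀ x, 0 ≤ q x) (hh0 : ∀ x, 0 < h x) (hlap : ∀ x, lap h x ≤ q x * h x)
    {R ε τ K : ℝ} (hε : 0 < ε) (hτ : 0 < τ) (hK : K < 4 * τ)
    (hsub : ∀ x, ‖x‖ ≤ R → 0 < w x → q x * w x - K ≤ lap w x)
    (hbd : ∀ x, ‖x‖ = R → w x ≤ ε * h x) {x : R2} (hx : ‖x‖ ≤ R) :
    w x ≤ ε * h x + τ * R ^ 2 := by
  have hn : ContDiff ℝ 2 fun x : R2 => ‖x‖ ^ 2 := contDiff_id.norm_sq ℝ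
  have hln : ∀ x, lap (fun x : R2 => ‖x‖ ^ 2) x = 4 := fun x => by
    have := lap_radial (F := fun t => t) (F₁ := fun _ => 1) (F₂ := fun _ => 0) (0 : R2)
      (fun t _ => hasDerivAt_id t) (fun t _ => hasDerivAt_const t 1) (by simpa using hn) x
    simpa using this
  have hεh : ContDiff ℝ 2 fun x => ε * h x := contDiff_const.mul hh
  have hτn : ContDiff ℝ 2 fun x : R2 => τ * ‖x‖ ^ 2 := contDiff_const.mul hn
  set k : R2 → ℝ := fun x => (w x - ε * h x) + τ * ‖x‖ ^ 2 with hk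
  have hkC : ContDiff ℝ 2 k := (hw.sub hεh).add hτn
  have hlk : ∀ x, lap k x = lap w x - ε * lap h x + τ * 4 := fun x => by
    rw [hk, lap_add (hw.sub hεh) hτn, lap_sub hw hεh, lap_const_mul hh, lap_const_mul hn, hln]
  obtain ⟨y, hy, hmax⟩ := (isCompact_closedBall (0 : R2) R).exists_isMaxOn
    ⟨x, by simpa using hx⟩ hkC.continuous.continuousOn
  have hyR : ‖y‖ ≤ R := by simpa using hy
  have hsq : ‖y‖ ^ 2 ≤ R ^ 2 := by gcongr
  have hky : k y ≤ τ * R ^ 2 := by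
    rcases hyR.eq_or_lt with he | hlt
    · have := hbd y he
      simp only [hk, he]
      linarith
    · by_contra! hgt
      have hwy : ε * h y < w y := by
        simp only [hk] at hgt
        nlinarith
      have hloc : IsLocalMax k y := hmax.isLocalMax
        (mem_of_superset (isOpen_ball.mem_nhds (by simpa using hlt)) ball_subset_closedBall)
      have h1 := lap_nonpos_of_isLocalMax hkC hloc
      rw [hlk] at h1
      have h2 := hsub y hyR ((mul_pos hε (hh0 y)).trans hwy)
      have h3 := mul_le_mul_of_nonneg_left (hlap y) hε.le
      have h4 := mul_le_mul_of_nonneg_left hwy.le (hq0 y)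
      nlinarith
  have hkx : k x ≤ k y := hmax (by simpa using hx)
  have : 0 ≤ τ * ‖x‖ ^ 2 := by positivity
  simp only [hk] at hkx hky
  linarith

/-- A subsolution of `Δ - q` on the plane growing slower than the logarithm is nonpositive. -/
lemma nonpos_of_subsolution {q w : R2 → ℝ} (hq : Continuous q) (hq0 : ∀ x, 0 ≤ q x) {p : R2}
    (hp : 0 < q p) (hw : ContDiff ℝ 2 w) (hsub : ∀ x, 0 < w x → q x * w x ≤ lap w x)
    (hgrow : ∀ ε > 0, ∀ᶠ x in cobounded R2, w x ≤ ε * Real.log ‖x‖) (x : R2) : w x ≤ 0 := by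
  obtain ⟨h, hh, hh0, hlap, hlog⟩ := exists_log_supersolution hq hq0 hp
  have key : ∀ ε > 0, w x ≤ ε * h x := by
    intro ε hε
    obtain ⟨R, -, hR⟩ := (hasBasis_cobounded_norm (E := R2)).eventually_iff.1
      ((hgrow ε hε).and hlog)
    set S := max R ‖x‖
    have hbd : ∀ y : R2, ‖y‖ = S → w y ≤ ε * h y := fun y hy => by
      obtain ⟨h1, h2⟩ := hR (x := y) (by simp [hy, S])
      exact h1.trans (by gcongr)
    refine le_of_forall_pos_le_add fun η hη => ?_
    have := le_of_subsolution_on_ball hw hh hq0 hh0 hlap (R := S) (K := 0) hε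
      (τ := η / (S ^ 2 + 1)) (by positivity) (by positivity)
      (fun y _ hy => by simpa using hsub y hy) hbd (le_max_right R ‖x‖)
    refine this.trans ?_
    gcongr
    rw [div_mul_eq_mul_div, div_le_iff₀ (by positivity)]
    nlinarith
  have hx := hh0 x
  refine le_of_forall_pos_le_add fun η hη => ?_
  have := key (η / h x) (by positivity)
  rwa [div_mul_cancel₀ _ hx.ne', ← zero_add η] at this

/-- A harmonic function on the plane cannot grow like a positive multiple of the logarithm. -/
lemma not_harmonic_of_tendsto_div_log {u : R2 → ℝ} (hu : ContDiff ℝ 2 u) {L : ℝ} (hL : 0 < L)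
    (has : Tendsto (fun x : R2 => u x / Real.log ‖x‖) (cobounded R2) (𝓝 L)) :
    ¬ ∀ x, lap u x = 0 := by
  intro hharm
  set F : ℝ → ℝ := fun t => Real.log (1 + t)
  set f : R2 → ℝ := fun x => F (‖x - 0‖ ^ 2)
  have hfC : ContDiff ℝ 2 f := by
    have h1 : ContDiff ℝ 2 fun x : R2 => 1 + ‖x - 0‖ ^ 2 :=
      contDiff_const.add ((contDiff_id.sub contDiff_const).norm_sq ℝ)
    exact h1.log fun x => by positivity
  have hlf : ∀ x, 0 < lap f x := by
    intro x
    have hadd : ∀ t : ℝ, HasDerivAt (fun t => 1 + t) 1 t := fun t => (hasDerivAt_id t).const_add 1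
    rw [lap_radial (F := F) (F₁ := fun t => 1 / (1 + t)) (F₂ := fun t => -1 / (1 + t) ^ 2) 0
      ?_ ?_ hfC]
    · have : 4 * ‖x - 0‖ ^ 2 * (-1 / (1 + ‖x - 0‖ ^ 2) ^ 2) + 4 * (1 / (1 + ‖x - 0‖ ^ 2))
          = 4 / (1 + ‖x - 0‖ ^ 2) ^ 2 := by
        have : 1 + ‖x - 0‖ ^ 2 ≠ 0 := by positivity
        field_simp
        ring
      rw [this]
      positivity
    · intro t ht
      exact (hadd t).log (by positivity)
    · intro t ht
      have hne : 1 + t ≠ 0 := by positivity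
      refine ((hasDerivAt_const t (1 : ℝ)).div (hadd t) hne).congr_deriv ?_
      field_simp
      ring
  set a := L / 8
  have ha : 0 < a := by positivity
  have haf : ContDiff ℝ 2 fun x => a * f x := contDiff_const.mul hfC
  set k : R2 → ℝ := fun x => a * f x - u x
  have hkC : ContDiff ℝ 2 k := haf.sub hu
  have hlogtop : Tendsto (fun x : R2 => Real.log ‖x‖) (cobounded R2) atTop :=
    Real.tendsto_log_atTop.comp tendsto_norm_cobounded_atTop
  have hev : ∀ᶠ x in cobounded R2, k x ≤ k 0 := by
    have hbig : ∀ᶠ x in cobounded R2, a * Real.log 2 - k 0 ≤ L / 4 * Real.log ‖x‖ :=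
      (hlogtop.const_mul_atTop (by positivity)).eventually_ge_atTop _
    filter_upwards [has.eventually (lt_mem_nhds (half_lt_self hL)), hbig,
      tendsto_norm_cobounded_atTop.eventually_gt_atTop 1] with x h1 h2 h3
    have hlog : 0 < Real.log ‖x‖ := Real.log_pos h3
    rw [lt_div_iff₀ hlog] at h1
    have h4 : f x ≤ Real.log 2 + 2 * Real.log ‖x‖ := by
      have : Real.log (1 + ‖x - 0‖ ^ 2) ≤ Real.log (2 * ‖x‖ ^ 2) := by
        apply Real.log_le_log (by positivity)
        rw [sub_zero]
        nlinarith
      rwa [Real.log_mul two_ne_zero (by positivity), Real.log_pow] at this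
    have h5 := mul_le_mul_of_nonneg_left h4 ha.le
    simp only [k, a] at h2 h5 ⊢
    linarith
  obtain ⟨y, hy⟩ := hkC.continuous.exists_forall_ge' 0
    (by rwa [← Metric.cobounded_eq_cocompact])
  have h1 := lap_nonpos_of_isLocalMax hkC (x := y) (Eventually.of_forall hy)
  have h2 : lap k y = a * lap f y - lap u y := by
    simp only [k]
    rw [lap_sub haf hu, lap_const_mul hfC]
  rw [h2, hharm y] at h1
  nlinarith [hlf y]

lemma eventually_sub_le_mul_log {u v : R2 → ℝ} {L : ℝ}
    (hu : Tendsto (fun x : R2 => u x / Real.log ‖x‖) (cobounded R2) (𝓝 L))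
    (hv : Tendsto (fun x : R2 => v x / Real.log ‖x‖) (cobounded R2) (𝓝 L)) {ε : ℝ} (hε : 0 < ε) :
    ∀ᶠ x in cobounded R2, u x - v x ≤ ε * Real.log ‖x‖ := by
  have h := hu.sub hv
  rw [sub_self] at h
  filter_upwards [h.eventually (gt_mem_nhds hε),
    tendsto_norm_cobounded_atTop.eventually_gt_atTop 1] with x h1 h2
  rw [← sub_div, div_lt_iff₀ (Real.log_pos h2)] at h1
  exact h1.le

lemma exp_mul_sub_le (a b : ℝ) : Real.exp b * (a - b) ≤ Real.exp a - Real.exp b := by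
  have h1 : Real.exp a = Real.exp b * Real.exp (a - b) := by rw [← Real.exp_add]; ring_nf
  rw [h1]
  nlinarith [Real.add_one_le_exp (a - b), Real.exp_pos b]

/-- Comparison principle for `Δu = c P e^u` and `Δv = c Q e^v` with `Q ≤ P`. -/
lemma le_of_lap_eq_exp {c : ℝ} (hc : 0 < c) {u v P Q : R2 → ℝ} (hu : ContDiff ℝ 2 u)
    (hv : ContDiff ℝ 2 v) (hlu : ∀ x, lap u x = c * P x * Real.exp (u x))
    (hlv : ∀ x, lap v x = c * Q x * Real.exp (v x)) (hQ : Continuous Q) (hQ0 : ∀ x, 0 ≤ Q x)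
    (hQP : ∀ x, Q x ≤ P x) {p : R2} (hp : 0 < Q p)
    (hgrow : ∀ ε > 0, ∀ᶠ x in cobounded R2, u x - v x ≤ ε * Real.log ‖x‖) (x : R2) :
    u x ≤ v x := by
  have := nonpos_of_subsolution (q := fun x => c * Q x * Real.exp (v x))
    (w := fun x => u x - v x) (p := p)
    ((continuous_const.mul hQ).mul (Real.continuous_exp.comp hv.continuous))
    (fun x => mul_nonneg (mul_nonneg hc.le (hQ0 x)) (Real.exp_pos _).le)
    (mul_pos (mul_pos hc hp) (Real.exp_pos _)) (hu.sub hv) (fun y _ => ?_) hgrow x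
  · linarith
  · rw [lap_sub hu hv, hlu, hlv]
    have h1 := mul_le_mul_of_nonneg_left (exp_mul_sub_le (u y) (v y))
      (mul_nonneg hc.le (hQ0 y))
    have h2 : c * Q y * Real.exp (u y) ≤ c * P y * Real.exp (u y) := by
      gcongr
      exact hQP y
    linarith

/-- Solutions of `Δψₙ = c Vₙ e^{ψₙ}` trapped between `φ₂` and `φ₁` of equal logarithmic growth form
a uniform Cauchy sequence on balls when `Vₙ` converges locally uniformly. -/
lemma uniformCauchySeqOn_closedBall {c : ℝ} (hc : 0 < c) {Vn : ℕ → R2 → ℝ} {V W : R2 → ℝ}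
    (hVconv : TendstoLocallyUniformly Vn V atTop) (hW : Continuous W) (hW0 : ∀ x, 0 ≤ W x)
    (hWV : ∀ n x, W x ≤ Vn n x) {p : R2} (hp : 0 < W p) {ψn : ℕ → R2 → ℝ}
    (hψC : ∀ n, ContDiff ℝ 2 (ψn n))
    (hψeq : ∀ n x, lap (ψn n) x = c * Vn n x * Real.exp (ψn n x)) {φ₁ φ₂ : R2 → ℝ}
    (hφ₁ : Continuous φ₁) (hφ₂ : Continuous φ₂) (hle₁ : ∀ n x, ψn n x ≤ φ₁ x)
    (hle₂ : ∀ n x, φ₂ x ≤ ψn n x)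
    (hgrow : ∀ ε > 0, ∀ᶠ x in cobounded R2, φ₁ x - φ₂ x ≤ ε * Real.log ‖x‖) (ρ : ℝ) :
    UniformCauchySeqOn ψn atTop (closedBall 0 ρ) := by
  set q : R2 → ℝ := fun x => c * W x * Real.exp (φ₂ x)
  have hq0 : ∀ x, 0 ≤ q x := fun x => mul_nonneg (mul_nonneg hc.le (hW0 x)) (Real.exp_pos _).le
  obtain ⟨h, hh, hh0, hlap, hlog⟩ := exists_log_supersolution (q := q)
    ((continuous_const.mul hW).mul (Real.continuous_exp.comp hφ₂)) hq0 (p := p)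
    (mul_pos (mul_pos hc hp) (Real.exp_pos _))
  rw [Metric.uniformCauchySeqOn_iff]
  intro η hη
  obtain ⟨H, hH⟩ := (isCompact_closedBall (0 : R2) ρ).exists_bound_of_continuousOn
    hh.continuous.continuousOn
  set ε := η / (4 * (|H| + 1))
  have hε : 0 < ε := by positivity
  have hεh : ∀ x ∈ closedBall (0 : R2) ρ, ε * h x ≤ η / 4 := fun x hx => by
    have h1 : h x ≤ |H| + 1 := by
      linarith [le_abs_self H, hH x hx, Real.le_norm_self (h x)]
    calc ε * h x ≤ ε * (|H| + 1) := by gcongr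
      _ = η / 4 := by simp only [ε]; field_simp
  obtain ⟨R₀, -, hR₀⟩ := (hasBasis_cobounded_norm (E := R2)).eventually_iff.1
    ((hgrow ε hε).and hlog)
  set R := max R₀ ρ
  set τ := η / (4 * (R ^ 2 + 1))
  have hτ : 0 < τ := by positivity
  have hτR : τ * R ^ 2 ≤ η / 4 := by
    simp only [τ]
    rw [div_mul_eq_mul_div, div_le_iff₀ (by positivity)]
    nlinarith
  obtain ⟨M, hM⟩ := (isCompact_closedBall (0 : R2) R).exists_bound_of_continuousOn
    hφ₁.continuousOn
  set δ := τ / (c * Real.exp M)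
  have hδ : 0 < δ := by positivity
  have hunif := (tendstoLocallyUniformly_iff_forall_isCompact.1 hVconv) _
    (isCompact_closedBall (0 : R2) R)
  obtain ⟨N, hN⟩ := Metric.uniformCauchySeqOn_iff.1 hunif.uniformCauchySeqOn δ hδ
  have key : ∀ m ≥ N, ∀ n ≥ N, ∀ x ∈ closedBall (0 : R2) ρ, ψn m x - ψn n x ≤ η / 2 := by
    intro m hm n hn x hx
    have hxR : ‖x‖ ≤ R := by
      rw [mem_closedBall_zero_iff] at hx
      exact hx.trans (le_max_right _ _)
    have := le_of_subsolution_on_ball (w := fun x => ψn m x - ψn n x) ((hψC m).sub (hψC n)) hh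
      hq0 hh0 hlap (K := τ) hε hτ (by linarith) (fun y hy hpos => ?_) (fun y hy => ?_) hxR
    · linarith [hεh x hx]
    · have hyR : y ∈ closedBall (0 : R2) R := by simpa using hy
      rw [lap_sub (hψC m) (hψC n), hψeq, hψeq]
      have h1 : c * Real.exp (ψn n y) * (Vn n y - Vn m y) ≤ τ := by
        have hd := hN n hn m hm y hyR
        rw [Real.dist_eq] at hd
        have h2 : Real.exp (ψn n y) ≤ Real.exp M := Real.exp_le_exp.2
          ((hle₁ n y).trans ((Real.le_norm_self _).trans (hM y hyR)))
        calc c * Real.exp (ψn n y) * (Vn n y - Vn m y)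
            ≤ c * Real.exp (ψn n y) * δ := by
              gcongr
              exact (le_abs_self _).trans hd.le
          _ ≤ c * Real.exp M * δ := by gcongr
          _ = τ := by simp only [δ]; field_simp
      have h3 : q y * (ψn m y - ψn n y)
          ≤ c * Vn m y * (Real.exp (ψn m y) - Real.exp (ψn n y)) := by
        have hexp := exp_mul_sub_le (ψn m y) (ψn n y)
        have hV0 : 0 ≤ Vn m y := (hW0 y).trans (hWV m y)
        calc q y * (ψn m y - ψn n y)
            ≤ c * Vn m y * Real.exp (ψn n y) * (ψn m y - ψn n y) := by
              simp only [q]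
              gcongr
              · exact hWV m y
              · exact hle₂ n y
          _ = c * Vn m y * (Real.exp (ψn n y) * (ψn m y - ψn n y)) := by ring
          _ ≤ _ := by gcongr
      linarith
    · obtain ⟨h1, h2⟩ := hR₀ (x := y) (by simp [hy, R])
      calc ψn m y - ψn n y ≤ φ₁ y - φ₂ y := by linarith [hle₁ m y, hle₂ n y]
        _ ≤ ε * Real.log ‖y‖ := h1
        _ ≤ ε * h y := by gcongr
  refine ⟨N, fun m hm n hn x hx => ?_⟩
  rw [Real.dist_eq, abs_lt]
  constructor
  · linarith [key n hn m hm x hx]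
  · linarith [key m hm n hn x hx]

/-- Weak formulation passes to the limit along a pointwise convergent sequence of dominated
classical solutions of `Δψₙ = gₙ`. -/
lemma isWeakSol_of_tendsto {ψn gn : ℕ → R2 → ℝ} {ψ g B₁ B₂ : R2 → ℝ}
    (hψC : ∀ n, ContDiff ℝ 2 (ψn n)) (heq : ∀ n x, lap (ψn n) x = -gn n x)
    (hB₁ : Continuous B₁) (hB₂ : Continuous B₂) (hψB : ∀ n x, |ψn n x| ≤ B₁ x)
    (hgB : ∀ n x, |gn n x| ≤ B₂ x) (hψ : ∀ x, Tendsto (fun n => ψn n x) atTop (𝓝 (ψ x)))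
    (hg : ∀ x, Tendsto (fun n => gn n x) atTop (𝓝 (g x))) : IsWeakSol ψ g := by
  intro φ hφ hc
  have hφ2 : ContDiff ℝ 2 φ := mod_cast contDiff_infty.1 hφ 2
  have hlapc : HasCompactSupport (lap φ) := by
    refine hc.mono' fun x hx => ?_
    by_contra hnot
    refine hx ?_
    have h0 : φ =ᶠ[𝓝 x] fun _ => 0 := notMem_tsupport_iff_eventuallyEq.1 hnot
    simp [lap, (h0.iteratedFDeriv ℝ 2).eq_of_nhds, iteratedFDeriv_fun_zero]
  have hint : ∀ {B k : R2 → ℝ}, Continuous B → Continuous k → HasCompactSupport k →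
      Integrable fun x => B x * |k x| := fun hB hk hkc =>
    (hB.mul hk.abs).integrable_of_hasCompactSupport (hkc.abs.mul_left)
  have hgc : ∀ n, Continuous (gn n) := fun n => by
    have : gn n = fun x => -lap (ψn n) x := by ext x; simp [heq]
    rw [this]
    exact (continuous_lap (hψC n)).neg
  have hl := continuous_lap hφ2
  have h1 : Tendsto (fun n => ∫ x, ψn n x * lap φ x) atTop (𝓝 (∫ x, ψ x * lap φ x)) := by
    refine tendsto_integral_of_dominated_convergence _
      (fun n => ((hψC n).continuous.mul hl).aestronglyMeasurable) (hint hB₁ hl hlapc)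
      (fun n => ae_of_all _ fun x => ?_) (ae_of_all _ fun x => (hψ x).mul_const _)
    rw [norm_mul]
    exact mul_le_mul_of_nonneg_right (hψB n x) (abs_nonneg _)
  have h2 : Tendsto (fun n => ∫ x, gn n x * φ x) atTop (𝓝 (∫ x, g x * φ x)) := by
    refine tendsto_integral_of_dominated_convergence _
      (fun n => ((hgc n).mul hφ.continuous).aestronglyMeasurable)
      (hint hB₂ hφ.continuous hc)
      (fun n => ae_of_all _ fun x => ?_) (ae_of_all _ fun x => (hg x).mul_const _)
    rw [norm_mul]
    exact mul_le_mul_of_nonneg_right (hgB n x) (abs_nonneg _)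
  refine tendsto_nhds_unique h1 (h2.neg.congr fun n => ?_)
  rw [integral_mul_lap_eq (hψC n) hφ2 hc, ← integral_neg]
  simp [heq]

/-- Corollary 5.1: stability of solutions under perturbations for β < 0. -/
theorem stability_beta_neg (β : ℝ) (hβ : β < 0)
    (α : ℝ≥0) (hα0 : 0 < α) (hα1 : (α : ℝ) ≤ 1)
    (Vn : ℕ → R2 → ℝ) (V : R2 → ℝ)
    (hVn0 : ∀ n x, 0 ≤ Vn n x)
    (hVnH : ∀ n, ∃ Ch : ℝ≥0, HolderWith Ch α (Vn n))
    (hVconv : TendstoLocallyUniformly Vn V atTop)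
    (ψn : ℕ → R2 → ℝ) (hψnC : ∀ n, ContDiff ℝ 2 (ψn n))
    (hψneq : ∀ n x, -lap (ψn n) x = 4 * π * β * Vn n x * Real.exp (ψn n x))
    (hψnas : ∀ n, Tendsto (fun x : R2 => ψn n x / Real.log ‖x‖) (cobounded R2)
      (nhds (-(2*β))))
    (W₁ W₂ : R2 → ℝ)
    (hW₁H : ∃ Ch : ℝ≥0, HolderWith Ch α W₁) (hW₂H : ∃ Ch : ℝ≥0, HolderWith Ch α W₂)
    (hWbound : ∀ n x, 0 ≤ W₁ x ∧ W₁ x ≤ Vn n x ∧ Vn n x ≤ W₂ x)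
    (φ₁ φ₂ : R2 → ℝ) (hφ₁C : ContDiff ℝ 2 φ₁) (hφ₂C : ContDiff ℝ 2 φ₂)
    (hφ₁eq : ∀ x, -lap φ₁ x = 4 * π * β * W₁ x * Real.exp (φ₁ x))
    (hφ₂eq : ∀ x, -lap φ₂ x = 4 * π * β * W₂ x * Real.exp (φ₂ x))
    (hφ₁as : Tendsto (fun x : R2 => φ₁ x / Real.log ‖x‖) (cobounded R2)
      (nhds (-(2*β))))
    (hφ₂as : Tendsto (fun x : R2 => φ₂ x / Real.log ‖x‖) (cobounded R2)
      (nhds (-(2*β)))) :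
    ∃ ψ : R2 → ℝ, Continuous ψ ∧ TendstoLocallyUniformly ψn ψ atTop ∧
      IsWeakSol ψ (fun x => 4 * π * β * V x * Real.exp (ψ x)) ∧
      Tendsto (fun x : R2 => ψ x / Real.log ‖x‖) (cobounded R2) (nhds (-(2*β))) := by
  set c := -(4 * π * β)
  have hc : 0 < c := by
    have := mul_neg_of_pos_of_neg (mul_pos four_pos Real.pi_pos) hβ
    simp only [c]
    linarith
  have lap_eq : ∀ {a b e : ℝ}, -a = 4 * π * β * b * e → a = c * b * e := fun h => by
    simp only [c]
    linarith
  have hW₁ : Continuous W₁ := hW₁H.choose_spec.continuous hα0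
  have hW₂ : Continuous W₂ := hW₂H.choose_spec.continuous hα0
  obtain ⟨p, hp⟩ : ∃ p, 0 < W₁ p := by
    by_contra! hcon
    refine not_harmonic_of_tendsto_div_log hφ₁C (by linarith) hφ₁as fun x => ?_
    rw [lap_eq (hφ₁eq x), le_antisymm (hcon x) (hWbound 0 x).1]
    simp
  have hle₁ : ∀ n x, ψn n x ≤ φ₁ x := fun n =>
    le_of_lap_eq_exp hc (hψnC n) hφ₁C (fun x => lap_eq (hψneq n x)) (fun x => lap_eq (hφ₁eq x))
      hW₁ (fun x => (hWbound n x).1) (fun x => (hWbound n x).2.1) hp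
      (fun _ hε => eventually_sub_le_mul_log (hψnas n) hφ₁as hε)
  have hle₂ : ∀ n x, φ₂ x ≤ ψn n x := fun n =>
    le_of_lap_eq_exp hc hφ₂C (hψnC n) (fun x => lap_eq (hφ₂eq x)) (fun x => lap_eq (hψneq n x))
      ((hVnH n).choose_spec.continuous hα0) (hVn0 n) (fun x => (hWbound n x).2.2)
      (hp.trans_le (hWbound n p).2.1)
      (fun _ hε => eventually_sub_le_mul_log hφ₂as (hψnas n) hε)
  have hcauchy := uniformCauchySeqOn_closedBall hc hVconv hW₁ (fun x => (hWbound 0 x).1)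
    (fun n x => (hWbound n x).2.1) hp hψnC (fun n x => lap_eq (hψneq n x)) hφ₁C.continuous
    hφ₂C.continuous hle₁ hle₂ (fun _ hε => eventually_sub_le_mul_log hφ₁as hφ₂as hε)
  choose ψ hψ using fun x : R2 =>
    cauchySeq_tendsto_of_complete ((hcauchy ‖x‖).cauchySeq (x := x) (by simp))
  have hunif : TendstoLocallyUniformly ψn ψ atTop := by
    rw [tendstoLocallyUniformly_iff_forall_isCompact]
    intro K hK
    obtain ⟨ρ, hρ⟩ := hK.isBounded.subset_closedBall 0
    exact ((hcauchy ρ).tendstoUniformlyOn_of_tendsto fun x _ => hψ x).mono hρ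
  have hψ₁ : ∀ x, ψ x ≤ φ₁ x := fun x => le_of_tendsto' (hψ x) fun n => hle₁ n x
  have hψ₂ : ∀ x, φ₂ x ≤ ψ x := fun x => ge_of_tendsto' (hψ x) fun n => hle₂ n x
  refine ⟨ψ, hunif.continuous (Frequently.of_forall fun n => (hψnC n).continuous), hunif, ?_, ?_⟩
  · refine isWeakSol_of_tendsto (gn := fun n x => 4 * π * β * Vn n x * Real.exp (ψn n x))
      (B₁ := fun x => |φ₁ x| + |φ₂ x|) (B₂ := fun x => c * W₂ x * Real.exp (φ₁ x)) hψnC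
      (fun n x => by linarith [hψneq n x])
      (hφ₁C.continuous.abs.add hφ₂C.continuous.abs)
      ((continuous_const.mul hW₂).mul (Real.continuous_exp.comp hφ₁C.continuous))
      (fun n x => ?_) (fun n x => ?_) hψ (fun x => ?_)
    · rw [abs_le]
      constructor
      · linarith [hle₂ n x, neg_abs_le (φ₂ x), abs_nonneg (φ₁ x)]
      · linarith [hle₁ n x, le_abs_self (φ₁ x), abs_nonneg (φ₂ x)]
    · have hV0 := hVn0 n x
      have h1 : 4 * π * β * Vn n x * Real.exp (ψn n x)
          = -(c * Vn n x * Real.exp (ψn n x)) := by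
        simp only [c]
        ring
      rw [h1, abs_neg, abs_of_nonneg (by positivity)]
      gcongr
      · exact mul_nonneg hc.le (hV0.trans (hWbound n x).2.2)
      · exact (hWbound n x).2.2
      · exact hle₁ n x
    · exact (((tendstoLocallyUniformlyOn_univ.2 hVconv).tendsto_at (Set.mem_univ x)).const_mul
        _).mul
        ((Real.continuous_exp.tendsto _).comp (hψ x))
  · refine tendsto_of_tendsto_of_tendsto_of_le_of_le' hφ₂as hφ₁as ?_ ?_ <;>
      filter_upwards [tendsto_norm_cobounded_atTop.eventually_gt_atTop 1] with x hx
    · exact div_le_div_of_nonneg_right (hψ₂ x) (Real.log_pos hx).le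
    · exact div_le_div_of_nonneg_right (hψ₁ x) (Real.log_pos hx).le
end
end

section
/- Spherical Onsager equation (Corollary 5.8). Let n ≥ 0, β > 0, l < 0, γ ≥ 0 with n + 2 + 2l < β < n + 2, and define K : ℝ² → ℝ by K(x) := (1 + ‖x‖²)^l · e^{2γ/(1+‖x‖²)}. Then there exists exactly one radially symmetric, twice continuously differentiable ψ : ℝ² → ℝ satisfying -Δψ(x) = 4πβ·‖x‖ⁿ·K(x)·e^{ψ(x)} for every x ∈ ℝ² and ∫_{ℝ²} ‖x‖ⁿ·K(x)·e^{ψ(x)} dx = 1. -/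
open MeasureTheory Real Filter Bornology Metric
open scoped NNReal

noncomputable section

open Topology Set

namespace SphericalOnsager

/-- `a` is a positive weight on `(0, ∞)` such that `s * a s` has logarithmic derivative `N s / s`. -/
structure IsWeight (a N : ℝ → ℝ) : Prop where
  pos : ∀ s, 0 < s → 0 < a s
  hasDerivAt : ∀ s, 0 < s → HasDerivAt (fun s => s * a s) (a s * N s) s

/-- The radial equation in the variable `s = ‖x‖ ^ 2`: the flux `m` of the potential `U`
is generated by the density `A * a * exp (-U)`. -/
structure IsRadialFlow (a : ℝ → ℝ) (A : ℝ) (U m : ℝ → ℝ) : Prop where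
  potential : ∀ s, 0 < s → HasDerivAt U (m s / s) s
  flux : ∀ s, 0 < s → HasDerivAt m (A * (a s * exp (-U s))) s
  flux_zero : Tendsto m (𝓝[>] 0) (𝓝 0)
  rate_zero : Tendsto (fun s => A * (s * a s * exp (-U s))) (𝓝[>] 0) (𝓝 0)

/-- The logarithmic rate of change `s * m'` of the flux. -/
def rate (a : ℝ → ℝ) (A : ℝ) (U : ℝ → ℝ) (s : ℝ) : ℝ := A * (s * a s * exp (-U s))

lemma lt_of_strictMonoOn_of_tendsto_zero {f : ℝ → ℝ} {b L : ℝ} (hf : StrictMonoOn f (Ioc 0 b))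
    (hL : Tendsto f (𝓝[>] 0) (𝓝 L)) {s : ℝ} (hs : s ∈ Ioc 0 b) : L < f s := by
  have h2 : s / 2 ∈ Ioc 0 b := ⟨by linarith [hs.1], by linarith [hs.1, hs.2]⟩
  refine lt_of_le_of_lt (le_of_tendsto hL ?_) (hf h2 hs (by linarith [hs.1]))
  filter_upwards [Ioo_mem_nhdsGT h2.1] with x hx
  exact hf.monotoneOn ⟨hx.1, hx.2.le.trans h2.2⟩ h2 hx.2.le

lemma lt_of_strictAntiOn_of_tendsto_atTop {f : ℝ → ℝ} {b L : ℝ} (hf : StrictAntiOn f (Ici b))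
    (hL : Tendsto f atTop (𝓝 L)) {s : ℝ} (hs : b ≤ s) : L < f s := by
  refine lt_of_le_of_lt (le_of_tendsto hL ?_) (hf (a := s) (b := s + 1) hs
    (mem_Ici.2 (by linarith)) (by linarith))
  filter_upwards [eventually_ge_atTop (s + 1)] with x hx
  exact hf.antitoneOn (mem_Ici.2 (by linarith)) (mem_Ici.2 (by linarith)) hx

lemma le_of_monotoneOn_of_tendsto_zero {f : ℝ → ℝ} {b L : ℝ} (hf : MonotoneOn f (Ioc 0 b))
    (hL : Tendsto f (𝓝[>] 0) (𝓝 L)) {s : ℝ} (hs : s ∈ Ioc 0 b) : L ≤ f s := by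
  refine le_of_tendsto hL ?_
  filter_upwards [Ioo_mem_nhdsGT hs.1] with x hx
  exact hf ⟨hx.1, hx.2.le.trans hs.2⟩ hs hx.2.le

lemma monotoneOn_of_hasDerivAt {f f' : ℝ → ℝ} {D : Set ℝ} (hD : Convex ℝ D)
    (hf : ∀ s ∈ D, HasDerivAt f (f' s) s) (h : ∀ s ∈ D, 0 ≤ f' s) : MonotoneOn f D :=
  monotoneOn_of_deriv_nonneg hD (fun s hs => (hf s hs).continuousAt.continuousWithinAt)
    (fun s hs => (hf s (interior_subset hs)).differentiableAt.differentiableWithinAt)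
    (fun s hs => (hf s (interior_subset hs)).deriv ▸ h s (interior_subset hs))

lemma antitoneOn_of_hasDerivAt {f f' : ℝ → ℝ} {D : Set ℝ} (hD : Convex ℝ D)
    (hf : ∀ s ∈ D, HasDerivAt f (f' s) s) (h : ∀ s ∈ D, f' s ≤ 0) : AntitoneOn f D :=
  antitoneOn_of_deriv_nonpos hD (fun s hs => (hf s hs).continuousAt.continuousWithinAt)
    (fun s hs => (hf s (interior_subset hs)).differentiableAt.differentiableWithinAt)
    (fun s hs => (hf s (interior_subset hs)).deriv ▸ h s (interior_subset hs))

/-- A function bounded above with `f' = g / s` and `g → L ≥ 0` forces `L = 0`. -/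
lemma eq_zero_of_tendsto_of_bddAbove {f g : ℝ → ℝ} {L B : ℝ}
    (hf : ∀ s, 0 < s → HasDerivAt f (g s / s) s) (hB : ∀ s, 0 < s → f s ≤ B)
    (hg : Tendsto g atTop (𝓝 L)) (hL : 0 ≤ L) : L = 0 := by
  by_contra hne
  have hL' : 0 < L := lt_of_le_of_ne hL (Ne.symm hne)
  obtain ⟨S, hS⟩ := (((hg.eventually (lt_mem_nhds (half_lt_self hL'))).and
    (eventually_gt_atTop 0))).exists_forall_of_atTop
  have hS0 := (hS S le_rfl).2
  have hmono : MonotoneOn (fun s => f s - L / 2 * log s) (Ici S) := by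
    refine monotoneOn_of_hasDerivAt (convex_Ici S) (f' := fun s => g s / s - L / 2 * s⁻¹)
      (fun s hs => (hf s (hS s hs).2).sub ((hasDerivAt_log (hS s hs).2.ne').const_mul _)) ?_
    intro s hs
    obtain ⟨h1, h2⟩ := hS s hs
    have : g s / s - L / 2 * s⁻¹ = (g s - L / 2) / s := by field_simp
    rw [this]
    exact div_nonneg (by linarith) h2.le
  obtain ⟨T, hT⟩ := ((tendsto_log_atTop.const_mul_atTop (half_pos hL')).eventually_gt_atTop
    (B - (f S - L / 2 * log S))).and (eventually_ge_atTop S) |>.exists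
  have := hmono (mem_Ici.2 le_rfl) (mem_Ici.2 hT.2) hT.2
  have h3 := hB T (hS0.trans_le hT.2)
  simp only at this
  linarith [hT.1]

namespace IsRadialFlow

variable {a N U m : ℝ → ℝ} {A : ℝ}

lemma rate_pos (ha : IsWeight a N) (hA : 0 < A) {s : ℝ} (hs : 0 < s) : 0 < rate a A U s := by
  have := ha.pos s hs
  unfold rate
  positivity

lemma hasDerivAt_flux (h : IsRadialFlow a A U m) {s : ℝ} (hs : 0 < s) :
    HasDerivAt m (rate a A U s / s) s := by
  convert h.flux s hs using 1
  unfold rate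
  field_simp

lemma hasDerivAt_rate (h : IsRadialFlow a A U m) (ha : IsWeight a N) {s : ℝ} (hs : 0 < s) :
    HasDerivAt (rate a A U) (rate a A U s / s * (N s - m s)) s := by
  refine HasDerivAt.congr_deriv
    ((((ha.hasDerivAt s hs).mul (h.potential s hs).neg.exp)).const_mul A) ?_
  simp only [rate, Pi.neg_apply]
  field_simp
  ring

/-- The defect from the logistic profile of total flux `2 * c`. -/
def defect (a : ℝ → ℝ) (A : ℝ) (U m : ℝ → ℝ) (c s : ℝ) : ℝ :=
  rate a A U s - m s * (2 * c - m s) / 2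

lemma hasDerivAt_defect (h : IsRadialFlow a A U m) (ha : IsWeight a N) (c : ℝ) {s : ℝ}
    (hs : 0 < s) :
    HasDerivAt (defect a A U m c) (rate a A U s / s * (N s - c)) s := by
  have hm := h.hasDerivAt_flux hs
  refine HasDerivAt.congr_deriv
    ((h.hasDerivAt_rate ha hs).sub ((hm.mul (hm.const_sub (2 * c))).div_const 2)) ?_
  ring

lemma tendsto_defect_zero (h : IsRadialFlow a A U m) (c : ℝ) :
    Tendsto (defect a A U m c) (𝓝[>] 0) (𝓝 0) := by
  have := h.rate_zero.sub ((h.flux_zero.mul (h.flux_zero.const_sub (2 * c))).div_const 2)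
  rw [zero_mul, zero_div, sub_zero] at this
  exact this

lemma strictMonoOn_flux (h : IsRadialFlow a A U m) (ha : IsWeight a N) (hA : 0 < A) :
    StrictMonoOn m (Ioi 0) :=
  strictMonoOn_of_deriv_pos (convex_Ioi 0)
    (fun s hs => (h.hasDerivAt_flux hs).continuousAt.continuousWithinAt) fun s hs => by
      rw [interior_Ioi] at hs
      rw [(h.hasDerivAt_flux hs).deriv]
      exact div_pos (rate_pos ha hA hs) hs

lemma flux_pos (h : IsRadialFlow a A U m) (ha : IsWeight a N) (hA : 0 < A) {s : ℝ} (hs : 0 < s) :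
    0 < m s :=
  lt_of_strictMonoOn_of_tendsto_zero ((h.strictMonoOn_flux ha hA).mono Ioc_subset_Ioi_self)
    h.flux_zero ⟨hs, le_rfl⟩

lemma flux_lt (h : IsRadialFlow a A U m) (ha : IsWeight a N) (hA : 0 < A) {β : ℝ}
    (hβ : Tendsto m atTop (𝓝 β)) {s : ℝ} (hs : 0 < s) : m s < β := by
  have hmono := h.strictMonoOn_flux ha hA
  refine lt_of_lt_of_le (hmono hs (mem_Ioi.2 (by linarith : 0 < s + 1)) (by linarith)) ?_
  refine ge_of_tendsto hβ ?_
  filter_upwards [eventually_ge_atTop (s + 1)] with x hx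
  exact hmono.monotoneOn (mem_Ioi.2 (by linarith)) (mem_Ioi.2 (by linarith)) hx

lemma strictAntiOn_defect (h : IsRadialFlow a A U m) (ha : IsWeight a N) (hA : 0 < A) {c S : ℝ}
    (hS : 0 < S) (hN : ∀ s, S < s → N s < c) : StrictAntiOn (defect a A U m c) (Ici S) :=
  strictAntiOn_of_deriv_neg (convex_Ici S)
    (fun s hs => (h.hasDerivAt_defect ha c
      (hS.trans_le hs)).continuousAt.continuousWithinAt) fun s hs => by
      rw [interior_Ici] at hs
      have hs0 := hS.trans hs
      rw [(h.hasDerivAt_defect ha c hs0).deriv]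
      exact mul_neg_of_pos_of_neg (div_pos (rate_pos ha hA hs0) hs0) (sub_neg.2 (hN s hs))

/-- A finite total flux forces the rate to vanish at infinity. -/
lemma tendsto_rate_atTop (h : IsRadialFlow a A U m) (ha : IsWeight a N) (hA : 0 < A) {c S M : ℝ}
    (hS : 0 < S) (hN : ∀ s, S < s → N s < c) (hM : Tendsto m atTop (𝓝 M)) :
    Tendsto (rate a A U) atTop (𝓝 0) := by
  have hanti := (h.strictAntiOn_defect ha hA hS hN).antitoneOn
  have hquad : Tendsto (fun s => m s * (2 * c - m s) / 2) atTop (𝓝 (M * (2 * c - M) / 2)) :=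
    (hM.mul (hM.const_sub _)).div_const 2
  have hbdd : ∀ s, 0 < s → -(c ^ 2 / 2) ≤ defect a A U m c s := fun s hs => by
    unfold defect
    nlinarith [rate_pos (U := U) ha hA hs, sq_nonneg (m s - c)]
  have hanti' : Antitone fun s => defect a A U m c (max s S) := fun x y hxy =>
    hanti (mem_Ici.2 (le_max_right _ _)) (mem_Ici.2 (le_max_right _ _)) (max_le_max_right S hxy)
  obtain ⟨G, hG⟩ : ∃ G, Tendsto (fun s => defect a A U m c (max s S)) atTop (𝓝 G) :=
    ⟨_, tendsto_atTop_ciInf hanti' ⟨-(c ^ 2 / 2), by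
      rintro _ ⟨s, rfl⟩
      exact hbdd _ (hS.trans_le (le_max_right _ _))⟩⟩
  have hG' : Tendsto (defect a A U m c) atTop (𝓝 G) := by
    refine hG.congr' ?_
    filter_upwards [eventually_ge_atTop S] with s hs
    rw [max_eq_left hs]
  have hr : Tendsto (rate a A U) atTop (𝓝 (G + M * (2 * c - M) / 2)) :=
    (hG'.add hquad).congr fun s => by unfold defect; ring
  have h0 : 0 ≤ G + M * (2 * c - M) / 2 := by
    refine ge_of_tendsto hr ?_
    filter_upwards [eventually_gt_atTop 0] with s hs using (rate_pos ha hA hs).le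
  rwa [eq_zero_of_tendsto_of_bddAbove (fun s hs => h.hasDerivAt_flux hs)
    (fun s hs => (h.flux_lt ha hA hM hs).le) hr h0] at hr

/-- If `N - β / 2` changes sign exactly once, a flow of total flux `β` lies strictly above the
logistic profile. -/
lemma defect_pos (h : IsRadialFlow a A U m) (ha : IsWeight a N) (hA : 0 < A) {c S : ℝ}
    (hS : 0 < S) (hN₁ : ∀ s, 0 < s → s < S → c < N s) (hN₂ : ∀ s, S < s → N s < c)
    (hM : Tendsto m atTop (𝓝 (2 * c))) {s : ℝ} (hs : 0 < s) : 0 < defect a A U m c s := by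
  rcases le_total s S with hsS | hsS
  · refine lt_of_strictMonoOn_of_tendsto_zero (b := S) ?_ (h.tendsto_defect_zero c) ⟨hs, hsS⟩
    refine strictMonoOn_of_deriv_pos (convex_Ioc 0 S)
      (fun s hs => (h.hasDerivAt_defect ha c hs.1).continuousAt.continuousWithinAt) fun s hs => ?_
    rw [interior_Ioc] at hs
    rw [(h.hasDerivAt_defect ha c hs.1).deriv]
    exact mul_pos (div_pos (rate_pos ha hA hs.1) hs.1) (sub_pos.2 (hN₁ s hs.1 hs.2))
  · refine lt_of_strictAntiOn_of_tendsto_atTop (h.strictAntiOn_defect ha hA hS hN₂) ?_ hsS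
    have := (h.tendsto_rate_atTop ha hA hS hN₂ hM).sub ((hM.mul (hM.const_sub (2 * c))).div_const 2)
    rw [sub_self, mul_zero, zero_div, sub_zero] at this
    exact this

lemma rate_le (h : IsRadialFlow a A U m) (ha : IsWeight a N) (hA : 0 < A) {M C : ℝ}
    (hM : Tendsto m atTop (𝓝 M)) (hr : Tendsto (rate a A U) atTop (𝓝 0))
    (hC : ∀ s, 0 < s → |N s| ≤ C) {s : ℝ} (hs : 0 < s) :
    rate a A U s ≤ C * m s ∧ rate a A U s ≤ (C + M) * (M - m s) := by
  have hlt := fun s hs => h.flux_lt ha hA hM (s := s) hs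
  have hpos := fun s hs => h.flux_pos ha hA (s := s) hs
  constructor
  · have hmono : MonotoneOn (fun s => C * m s - rate a A U s) (Ioc 0 s) := by
      refine monotoneOn_of_hasDerivAt (convex_Ioc 0 s) (fun x hx =>
        ((h.hasDerivAt_flux hx.1).const_mul C).sub (h.hasDerivAt_rate ha hx.1)) fun x hx => ?_
      have h1 := div_pos (rate_pos (U := U) ha hA hx.1) hx.1
      nlinarith [(abs_le.1 (hC x hx.1)).2, hpos x hx.1]
    have := le_of_monotoneOn_of_tendsto_zero hmono (L := 0)
      (by simpa [rate] using (h.flux_zero.const_mul C).sub h.rate_zero) ⟨hs, le_rfl⟩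
    simpa using this
  · have hanti : AntitoneOn (fun s => (C + M) * (M - m s) - rate a A U s) (Ici s) := by
      refine antitoneOn_of_hasDerivAt (convex_Ici s) (fun x hx =>
        (((h.hasDerivAt_flux (hs.trans_le hx)).const_sub M).const_mul (C + M)).sub
          (h.hasDerivAt_rate ha (hs.trans_le hx))) fun x hx => ?_
      have hx0 : 0 < x := hs.trans_le hx
      have h1 := div_pos (rate_pos (U := U) ha hA hx0) hx0
      nlinarith [(abs_le.1 (hC x hx0)).1, hlt x hx0]
    have hlim : Tendsto (fun s => (C + M) * (M - m s) - rate a A U s) atTop (𝓝 0) := by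
      simpa using ((hM.const_sub M).const_mul (C + M)).sub hr
    have : 0 ≤ (C + M) * (M - m s) - rate a A U s := by
      refine le_of_tendsto hlim ?_
      filter_upwards [eventually_ge_atTop s] with x hx
      exact hanti (mem_Ici.2 le_rfl) (mem_Ici.2 hx) hx
    linarith

end IsRadialFlow

/-- The pointwise inequality behind the uniqueness of flows with prescribed total flux;
`m i` are the fluxes and `ρ i` the ratios of the rates to the logistic profile. -/
lemma logistic_comparison {β m₁ m₂ ρ₁ ρ₂ : ℝ} (h₁ : 0 < m₁) (h₂ : 0 < m₂) (h₁' : m₁ < β)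
    (h₂' : m₂ < β) (hρ₁ : 0 < ρ₁) (hρ₂ : 0 < ρ₂) :
    (ρ₂ * (m₂ * (β - m₂)) - ρ₁ * (m₁ * (β - m₁))) * (log ρ₁ - log ρ₂) +
      (m₂ - m₁) * ((ρ₂ * (β - 2 * m₂) + m₂) - (ρ₁ * (β - 2 * m₁) + m₁)) ≤
      (1 - ρ₁ - ρ₂) * (m₂ - m₁) ^ 2 := by
  have e₁ : 1 - ρ₁ / ρ₂ ≤ log ρ₂ - log ρ₁ := by
    have := log_le_sub_one_of_pos (div_pos hρ₁ hρ₂)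
    rw [log_div hρ₁.ne' hρ₂.ne'] at this
    linarith
  have e₂ : 1 - ρ₂ / ρ₁ ≤ log ρ₁ - log ρ₂ := by
    have := log_le_sub_one_of_pos (div_pos hρ₂ hρ₁)
    rw [log_div hρ₂.ne' hρ₁.ne'] at this
    linarith
  have q₁ : 0 < m₁ * (β - m₁) := mul_pos h₁ (sub_pos.2 h₁')
  have q₂ : 0 < m₂ * (β - m₂) := mul_pos h₂ (sub_pos.2 h₂')
  have f₁ : m₂ * (β - m₂) * (ρ₂ - ρ₁) ≤ ρ₂ * (m₂ * (β - m₂)) * (log ρ₂ - log ρ₁) := by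
    refine le_trans (le_of_eq ?_) (mul_le_mul_of_nonneg_left e₁ (mul_pos hρ₂ q₂).le)
    field_simp
  have f₂ : m₁ * (β - m₁) * (ρ₁ - ρ₂) ≤ ρ₁ * (m₁ * (β - m₁)) * (log ρ₁ - log ρ₂) := by
    refine le_trans (le_of_eq ?_) (mul_le_mul_of_nonneg_left e₂ (mul_pos hρ₁ q₁).le)
    field_simp
  linear_combination f₁ + f₂

namespace IsRadialFlow

variable {a N U m : ℝ → ℝ} {A : ℝ}

/-- The ratio of the rate to the (doubled) logistic profile of total flux `β`. -/
def ratio (a : ℝ → ℝ) (A : ℝ) (U m : ℝ → ℝ) (β s : ℝ) : ℝ :=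
  rate a A U s / (m s * (β - m s))

lemma hasDerivAt_log_ratio (h : IsRadialFlow a A U m) (ha : IsWeight a N) (hA : 0 < A) {β : ℝ}
    (hβ : Tendsto m atTop (𝓝 β)) {s : ℝ} (hs : 0 < s) :
    HasDerivAt (fun s => log (ratio a A U m β s))
      ((N s - (ratio a A U m β s * (β - 2 * m s) + m s)) / s) s := by
  have hm := h.hasDerivAt_flux hs
  have hpos := h.flux_pos ha hA hs
  have hlt := sub_pos.2 (h.flux_lt ha hA hβ hs)
  have hr := rate_pos (U := U) ha hA hs
  refine HasDerivAt.congr_deriv (((h.hasDerivAt_rate ha hs).div (hm.mul (hm.const_sub β))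
    (mul_pos hpos hlt).ne').log (div_pos hr (mul_pos hpos hlt)).ne') ?_
  simp only [ratio, Pi.div_apply, Pi.mul_apply]
  field_simp
  ring

/-- The ratio to the logistic profile lies between two positive constants. -/
lemma ratio_bounds (h : IsRadialFlow a A U m) (ha : IsWeight a N) (hA : 0 < A) {β S C : ℝ}
    (hβ0 : 0 < β) (hS : 0 < S) (hN₁ : ∀ s, 0 < s → s < S → β / 2 < N s)
    (hN₂ : ∀ s, S < s → N s < β / 2) (hC : ∀ s, 0 < s → |N s| ≤ C)
    (hM : Tendsto m atTop (𝓝 β)) {s : ℝ} (hs : 0 < s) :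
    1 / 2 < ratio a A U m β s ∧ ratio a A U m β s ≤ 2 * (C + β) / β := by
  have hpos := h.flux_pos ha hA hs
  have hlt := sub_pos.2 (h.flux_lt ha hA hM hs)
  have hq := mul_pos hpos hlt
  have hM' : Tendsto m atTop (𝓝 (2 * (β / 2))) := by rwa [mul_div_cancel₀ _ two_ne_zero]
  constructor
  · have := h.defect_pos ha hA hS hN₁ hN₂ hM' hs
    rw [ratio, lt_div_iff₀ hq]
    unfold defect at this
    linarith
  · obtain ⟨h1, h2⟩ := h.rate_le ha hA hM (h.tendsto_rate_atTop ha hA hS hN₂ hM) hC hs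
    rw [ratio, div_le_div_iff₀ hq hβ0]
    nlinarith [mul_le_mul_of_nonneg_right h1 hlt.le, mul_le_mul_of_nonneg_right h2 hpos.le]

/-- Uniqueness of the flow with total flux `β` and rate generated by `A * a`. -/
lemma unique {U₁ m₁ U₂ m₂ : ℝ → ℝ} (h₁ : IsRadialFlow a A U₁ m₁) (h₂ : IsRadialFlow a A U₂ m₂)
    (ha : IsWeight a N) (hA : 0 < A) {β S C : ℝ}
    (hβ0 : 0 < β) (hS : 0 < S) (hN₁ : ∀ s, 0 < s → s < S → β / 2 < N s)
    (hN₂ : ∀ s, S < s → N s < β / 2) (hC : ∀ s, 0 < s → |N s| ≤ C)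
    (hM₁ : Tendsto m₁ atTop (𝓝 β)) (hM₂ : Tendsto m₂ atTop (𝓝 β)) :
    ∀ s, 0 < s → U₁ s = U₂ s := by
  set ρ₁ := ratio a A U₁ m₁ β
  set ρ₂ := ratio a A U₂ m₂ β
  have b₁ : ∀ s, 0 < s → 1 / 2 < ρ₁ s ∧ ρ₁ s ≤ 2 * (C + β) / β := fun s hs =>
    h₁.ratio_bounds ha hA hβ0 hS hN₁ hN₂ hC hM₁ hs
  have b₂ : ∀ s, 0 < s → 1 / 2 < ρ₂ s ∧ ρ₂ s ≤ 2 * (C + β) / β := fun s hs =>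
    h₂.ratio_bounds ha hA hβ0 hS hN₁ hN₂ hC hM₂ hs
  have p₁ : ∀ s, 0 < s → 0 < m₁ s := fun s hs => h₁.flux_pos ha hA hs
  have p₂ : ∀ s, 0 < s → 0 < m₂ s := fun s hs => h₂.flux_pos ha hA hs
  have l₁ : ∀ s, 0 < s → m₁ s < β := fun s hs => h₁.flux_lt ha hA hM₁ hs
  have l₂ : ∀ s, 0 < s → m₂ s < β := fun s hs => h₂.flux_lt ha hA hM₂ hs
  set X : ℝ → ℝ := fun s => (m₂ s - m₁ s) * (log (ρ₁ s) - log (ρ₂ s)) with hX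
  have rate_eq : ∀ {U m : ℝ → ℝ} {s : ℝ}, 0 < m s → m s < β →
      rate a A U s = ratio a A U m β s * (m s * (β - m s)) := fun hp hl =>
    (div_mul_cancel₀ _ (mul_pos hp (sub_pos.2 hl)).ne').symm
  obtain ⟨X', hX', hle⟩ : ∃ X' : ℝ → ℝ, (∀ s, 0 < s → HasDerivAt X (X' s) s) ∧
      ∀ s, 0 < s → X' s ≤ (1 - ρ₁ s - ρ₂ s) * (m₂ s - m₁ s) ^ 2 / s := by
    refine ⟨_, fun s hs => ((h₂.hasDerivAt_flux hs).sub (h₁.hasDerivAt_flux hs)).mul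
      ((h₁.hasDerivAt_log_ratio ha hA hM₁ hs).sub (h₂.hasDerivAt_log_ratio ha hA hM₂ hs)),
      fun s hs => ?_⟩
    have key := logistic_comparison (p₁ s hs) (p₂ s hs) (l₁ s hs) (l₂ s hs)
      (one_half_pos.trans (b₁ s hs).1) (one_half_pos.trans (b₂ s hs).1)
    rw [le_div_iff₀ hs]
    refine le_trans (le_of_eq ?_) key
    simp only [Pi.sub_apply]
    rw [rate_eq (U := U₁) (p₁ s hs) (l₁ s hs), rate_eq (U := U₂) (p₂ s hs) (l₂ s hs)]
    simp only [ρ₁, ρ₂]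
    field_simp
    ring
  have hanti : AntitoneOn X (Ioi 0) := by
    refine antitoneOn_of_hasDerivAt (convex_Ioi 0) hX' fun s hs => (hle s hs).trans ?_
    refine div_nonpos_of_nonpos_of_nonneg ?_ (le_of_lt hs)
    exact mul_nonpos_of_nonpos_of_nonneg (by linarith [(b₁ s hs).1, (b₂ s hs).1]) (sq_nonneg _)
  set D := log (2 * (C + β) / β) - log (1 / 2)
  have hbd : ∀ s, 0 < s → |log (ρ₁ s) - log (ρ₂ s)| ≤ D := by
    intro s hs
    have i₁ := log_le_log one_half_pos (b₁ s hs).1.le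
    have i₂ := log_le_log one_half_pos (b₂ s hs).1.le
    have j₁ := log_le_log (one_half_pos.trans (b₁ s hs).1) (b₁ s hs).2
    have j₂ := log_le_log (one_half_pos.trans (b₂ s hs).1) (b₂ s hs).2
    rw [abs_le]
    constructor <;> linarith
  have hlim : ∀ f : Filter ℝ, (∀ᶠ s in f, 0 < s) → Tendsto (fun s => m₂ s - m₁ s) f (𝓝 0) →
      Tendsto X f (𝓝 0) := by
    intro f hf hm
    refine squeeze_zero_norm' (a := fun s => |m₂ s - m₁ s| * D) ?_ (by simpa using hm.abs.mul_const D)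
    filter_upwards [hf] with s hs
    rw [hX, norm_eq_abs, abs_mul]
    exact mul_le_mul_of_nonneg_left (hbd s hs) (abs_nonneg _)
  have X0 : ∀ s, 0 < s → X s = 0 := by
    intro s hs
    apply le_antisymm
    · refine ge_of_tendsto (hlim (𝓝[>] 0) self_mem_nhdsWithin
        (by simpa using h₂.flux_zero.sub h₁.flux_zero)) ?_
      filter_upwards [Ioo_mem_nhdsGT hs] with x hx using hanti hx.1 hs hx.2.le
    · refine le_of_tendsto (hlim atTop (eventually_gt_atTop 0) (by simpa using hM₂.sub hM₁)) ?_
      filter_upwards [eventually_ge_atTop s] with x hx using hanti hs (hs.trans_le hx) hx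
  have meq : ∀ s, 0 < s → m₁ s = m₂ s := by
    intro s hs
    have hX0 : X' s = 0 := by
      refine (hX' s hs).unique ((hasDerivAt_const s (0 : ℝ)).congr_of_eventuallyEq ?_)
      filter_upwards [lt_mem_nhds hs] with x hx using X0 x hx
    have := hle s hs
    rw [hX0, le_div_iff₀ hs, zero_mul] at this
    have hsq : (m₂ s - m₁ s) ^ 2 ≤ 0 := by
      nlinarith [(b₁ s hs).1, (b₂ s hs).1, sq_nonneg (m₂ s - m₁ s)]
    nlinarith [pow_eq_zero_iff (two_ne_zero) |>.1 (le_antisymm hsq (sq_nonneg _))]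
  intro s hs
  have hd : rate a A U₁ s / s = rate a A U₂ s / s := by
    refine (h₁.hasDerivAt_flux hs).unique ((h₂.hasDerivAt_flux hs).congr_of_eventuallyEq ?_)
    filter_upwards [lt_mem_nhds hs] with x hx using meq x hx
  have hpos := ha.pos s hs
  rw [div_left_inj' hs.ne', rate, rate, mul_right_inj' hA.ne',
    mul_right_inj' (mul_pos hs hpos).ne', exp_eq_exp, neg_inj] at hd
  exact hd

/-- A strictly negative defect at a point where `N < c` from there on traps the flux
below `2 * c`. -/
lemma flux_le_of_defect_neg (h : IsRadialFlow a A U m) (ha : IsWeight a N) (hA : 0 < A) {c T : ℝ}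
    (hT : 0 < T) (hN : ∀ s, T < s → N s < c) (hG : defect a A U m c T < 0) (hm : m T < 2 * c)
    {s : ℝ} (hs : 0 < s) : m s < 2 * c := by
  by_contra! hcon
  have hTs : T < s := (h.strictMonoOn_flux ha hA).lt_iff_lt hT hs |>.1 (hm.trans_le hcon)
  have hcont : ContinuousOn m (Icc T s) := fun x hx =>
    (h.hasDerivAt_flux (hT.trans_le hx.1)).continuousAt.continuousWithinAt
  obtain ⟨x, hx, hxm⟩ := intermediate_value_Icc hTs.le hcont ⟨hm.le, hcon⟩
  have h1 := (h.strictAntiOn_defect ha hA hT hN).antitoneOn (mem_Ici.2 le_rfl) hx.1 hx.1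
  have h2 := rate_pos (U := U) ha hA (hT.trans_le hx.1)
  have h3 : defect a A U m c x = rate a A U x := by simp [defect, hxm]
  linarith

/-- Either the total flux is `2 * c`, or the flux exceeds it, or the defect becomes negative. -/
lemma trichotomy (h : IsRadialFlow a A U m) (ha : IsWeight a N) (hA : 0 < A) {c S : ℝ}
    (hS : 0 < S) (hN : ∀ s, S < s → N s < c) :
    Tendsto m atTop (𝓝 (2 * c)) ∨ (∃ s, 0 < s ∧ 2 * c < m s) ∨
      ∃ T, S ≤ T ∧ defect a A U m c T < 0 ∧ m T < 2 * c := by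
  by_cases hP : ∃ s, 0 < s ∧ 2 * c < m s
  · exact Or.inr (Or.inl hP)
  push Not at hP
  have hmono : Monotone fun s => m (max s S) := fun x y hxy =>
    (h.strictMonoOn_flux ha hA).monotoneOn (hS.trans_le (le_max_right _ _))
      (hS.trans_le (le_max_right _ _)) (max_le_max_right S hxy)
  have hlim := tendsto_atTop_ciSup hmono ⟨2 * c, by
    rintro _ ⟨s, rfl⟩
    exact hP _ (hS.trans_le (le_max_right _ _))⟩
  set M := ⨆ s, m (max s S)
  have hM : Tendsto m atTop (𝓝 M) := by
    refine hlim.congr' ?_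
    filter_upwards [eventually_ge_atTop S] with s hs
    rw [max_eq_left hs]
  have hle : M ≤ 2 * c := by
    refine le_of_tendsto hM ?_
    filter_upwards [eventually_gt_atTop 0] with s hs using hP s hs
  rcases hle.eq_or_lt with heq | hlt
  · exact Or.inl (heq ▸ hM)
  · have hM0 : 0 < M := (h.flux_pos ha hA hS).trans (h.flux_lt ha hA hM hS)
    have hG : Tendsto (defect a A U m c) atTop (𝓝 (0 - M * (2 * c - M) / 2)) :=
      (h.tendsto_rate_atTop ha hA hS hN hM).sub ((hM.mul (hM.const_sub _)).div_const 2)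
    have hneg : 0 - M * (2 * c - M) / 2 < 0 := by nlinarith
    obtain ⟨T, hT1, hT2⟩ := ((hG.eventually (gt_mem_nhds hneg)).and (eventually_ge_atTop S)).exists
    exact Or.inr (Or.inr ⟨T, hT2, hT1, (h.flux_lt ha hA hM (hS.trans_le hT2)).trans hlt⟩)

/-- For large amplitudes, the flux exceeds any level below twice the initial growth exponent. -/
lemma flux_gt_of_amplitude (h : IsRadialFlow a A U m) (ha : IsWeight a N) (hA : 0 < A)
    (hU : Tendsto U (𝓝[>] 0) (𝓝 0)) {b c δ : ℝ} (hcb : c < b) (hδ : 0 < δ)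
    (hN : ∀ s, 0 < s → s ≤ δ → b ≤ N s) {I : ℝ → ℝ}
    (hI : ∀ s, 0 < s → HasDerivAt I (a s) s) (hI0 : Tendsto I (𝓝[>] 0) (𝓝 0))
    (hlarge : 2 * c < A * exp (-(2 * c / (b - c))) * I δ) : 2 * c < m δ := by
  by_contra! hle
  have hbc := sub_pos.2 hcb
  have hm_le : ∀ s, 0 < s → s ≤ δ → m s ≤ 2 * c := fun s hs hsδ =>
    ((h.strictMonoOn_flux ha hA).monotoneOn hs hδ hsδ).trans hle
  have hdef : ∀ s ∈ Ioc 0 δ, 0 ≤ defect a A U m b s := fun s hs => by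
    refine le_of_monotoneOn_of_tendsto_zero ?_ (h.tendsto_defect_zero b) hs
    refine monotoneOn_of_hasDerivAt (convex_Ioc 0 δ)
      (fun x hx => h.hasDerivAt_defect ha b hx.1) fun x hx => ?_
    exact mul_nonneg (div_pos (rate_pos ha hA hx.1) hx.1).le (sub_nonneg.2 (hN x hx.1 hx.2))
  have hrate : ∀ s ∈ Ioc 0 δ, (b - c) * m s ≤ rate a A U s := fun s hs => by
    have h1 := hdef s hs
    have h2 := h.flux_pos ha hA hs.1
    unfold defect at h1
    nlinarith [hm_le s hs.1 hs.2]
  have hUle : ∀ s ∈ Ioc 0 δ, U s ≤ 2 * c / (b - c) := fun s hs => by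
    have hmono : MonotoneOn (fun s => m s / (b - c) - U s) (Ioc 0 δ) := by
      refine monotoneOn_of_hasDerivAt (convex_Ioc 0 δ) (fun x hx =>
        ((h.hasDerivAt_flux hx.1).div_const (b - c)).sub (h.potential x hx.1)) fun x hx => ?_
      rw [div_right_comm, ← sub_div]
      refine div_nonneg (sub_nonneg.2 ?_) hx.1.le
      rw [le_div_iff₀ hbc, mul_comm]
      exact hrate x hx
    have h1 := le_of_monotoneOn_of_tendsto_zero hmono (L := 0)
      (by simpa using (h.flux_zero.div_const (b - c)).sub hU) hs
    have h2 := div_le_div_of_nonneg_right (hm_le s hs.1 hs.2) hbc.le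
    linarith
  have hmono : MonotoneOn (fun s => m s - A * exp (-(2 * c / (b - c))) * I s) (Ioc 0 δ) := by
    refine monotoneOn_of_hasDerivAt (convex_Ioc 0 δ) (fun x hx =>
      (h.flux x hx.1).sub ((hI x hx.1).const_mul _)) fun x hx => ?_
    have h1 : exp (-(2 * c / (b - c))) ≤ exp (-U x) := exp_le_exp.2 (neg_le_neg (hUle x hx))
    have h2 := mul_le_mul_of_nonneg_left h1 (mul_pos hA (ha.pos x hx.1)).le
    linarith
  have := le_of_monotoneOn_of_tendsto_zero hmono (L := 0)
    (by simpa using h.flux_zero.sub (hI0.const_mul _)) ⟨hδ, le_rfl⟩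
  linarith

end IsRadialFlow

/-- The average `∫₀¹ f (σ θ) dθ`. -/
def avg (f : ℝ → ℝ) (σ : ℝ) : ℝ := ∫ θ in (0 : ℝ)..1, f (σ * θ)

lemma continuous_avg {f : ℝ → ℝ} (hf : Continuous f) : Continuous (avg f) :=
  intervalIntegral.continuous_parametric_intervalIntegral_of_continuous' (by fun_prop) 0 1

lemma mul_avg (f : ℝ → ℝ) (σ : ℝ) : σ * avg f σ = ∫ ξ in (0 : ℝ)..σ, f ξ := by
  rw [avg, intervalIntegral.mul_integral_comp_mul_left]
  simp

lemma avg_le {f : ℝ → ℝ} {σ C : ℝ} (hf : Continuous f) (hσ : 0 ≤ σ)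
    (h : ∀ ξ, 0 ≤ ξ → ξ ≤ σ → f ξ ≤ C) : avg f σ ≤ C := by
  have := intervalIntegral.integral_mono_on (μ := volume) (zero_le_one' ℝ)
    (f := fun θ => f (σ * θ)) (g := fun _ => C)
    (Continuous.intervalIntegrable (by fun_prop) _ _) (by simp)
    (fun θ hθ => h _ (mul_nonneg hσ hθ.1) (mul_le_of_le_one_right hσ hθ.2))
  simpa [avg] using this

lemma avg_nonneg {f : ℝ → ℝ} {σ : ℝ} (hf : ∀ ξ, 0 ≤ f ξ) : 0 ≤ avg f σ :=
  intervalIntegral.integral_nonneg zero_le_one fun _ _ => hf _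

lemma avg_sub {f g : ℝ → ℝ} (hf : Continuous f) (hg : Continuous g) (σ : ℝ) :
    avg f σ - avg g σ = avg (fun s => f s - g s) σ :=
  (intervalIntegral.integral_sub (Continuous.intervalIntegrable (by fun_prop) _ _)
    (Continuous.intervalIntegrable (by fun_prop) _ _)).symm

/-- The density generated by the positive part of a potential. -/
def dens (a U : ℝ → ℝ) (s : ℝ) : ℝ := a s * exp (-max 0 (U s))

/-- The potential generated by `dens a U`, extended by zero to negative arguments. -/
def pot (a U : ℝ → ℝ) (s : ℝ) : ℝ := ∫ σ in (0 : ℝ)..max s 0, avg (dens a U) σ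

lemma continuous_dens {a U : ℝ → ℝ} (ha : Continuous a) (hU : Continuous U) :
    Continuous (dens a U) := by
  unfold dens
  fun_prop

lemma continuous_pot {a U : ℝ → ℝ} (ha : Continuous a) (hU : Continuous U) :
    Continuous (pot a U) :=
  (intervalIntegral.continuous_primitive
    (fun _ _ => (continuous_avg (continuous_dens ha hU)).intervalIntegrable _ _) 0).comp
    (by fun_prop : Continuous fun s : ℝ => max s 0)

lemma dens_nonneg {a : ℝ → ℝ} (ha : ∀ s, 0 ≤ a s) (U : ℝ → ℝ) (s : ℝ) : 0 ≤ dens a U s :=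
  mul_nonneg (ha s) (exp_pos _).le

lemma pot_nonneg {a : ℝ → ℝ} (ha : ∀ s, 0 ≤ a s) (U : ℝ → ℝ) (s : ℝ) : 0 ≤ pot a U s :=
  intervalIntegral.integral_nonneg (le_max_right _ _) fun _ _ => avg_nonneg (dens_nonneg ha U)

lemma dens_le {a : ℝ → ℝ} (ha : ∀ s, 0 ≤ a s) (U : ℝ → ℝ) (s : ℝ) : dens a U s ≤ a s :=
  mul_le_of_le_one_right (ha s) (exp_le_one_iff.2 (by simp))

lemma abs_exp_neg_sub_exp_neg_le {x y : ℝ} (hx : 0 ≤ x) (hy : 0 ≤ y) :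
    |exp (-x) - exp (-y)| ≤ |x - y| := by
  wlog hxy : x ≤ y generalizing x y
  · rw [abs_sub_comm, abs_sub_comm x]
    exact this hy hx (le_of_not_ge hxy)
  rw [abs_of_nonneg (sub_nonneg.2 (exp_le_exp.2 (neg_le_neg hxy))),
    abs_sub_comm, abs_of_nonneg (sub_nonneg.2 hxy)]
  have h1 := add_one_le_exp (-(y - x))
  have h2 : exp (-y) = exp (-x) * exp (-(y - x)) := by rw [← exp_add]; ring_nf
  have h3 : exp (-x) ≤ 1 := exp_le_one_iff.2 (by linarith)
  nlinarith [exp_pos (-x)]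

lemma abs_dens_sub_le {a : ℝ → ℝ} (ha : ∀ s, 0 ≤ a s) (U V : ℝ → ℝ) (s : ℝ) :
    |dens a U s - dens a V s| ≤ a s * |U s - V s| := by
  rw [dens, dens, ← mul_sub, abs_mul, abs_of_nonneg (ha s)]
  refine mul_le_mul_of_nonneg_left ?_ (ha s)
  refine (abs_exp_neg_sub_exp_neg_le (le_max_left _ _) (le_max_left _ _)).trans ?_
  simpa [max_comm] using abs_max_sub_max_le_abs (U s) (V s) 0

/-- The exponential weight of the norm in which the potential map contracts. -/
def expWeight (L α s : ℝ) : ℝ := exp (L * (max s 0) ^ (α + 1))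

lemma continuous_expWeight {L α : ℝ} (hα : 0 ≤ α) : Continuous (expWeight L α) := by
  unfold expWeight
  have : Continuous fun s : ℝ => (max s 0) ^ (α + 1) :=
    (by fun_prop : Continuous fun s : ℝ => max s 0).rpow_const fun _ => Or.inr (by linarith)
  fun_prop

lemma expWeight_pos (L α s : ℝ) : 0 < expWeight L α s := exp_pos _

lemma expWeight_mono {L α : ℝ} (hL : 0 ≤ L) (hα : 0 ≤ α) : Monotone (expWeight L α) :=
  fun s t hst => exp_le_exp.2 <| mul_le_mul_of_nonneg_left
    (rpow_le_rpow (le_max_right _ _) (max_le_max_right 0 hst) (by linarith)) hL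

lemma integral_rpow_mul_expWeight {L α : ℝ} (hα : 0 ≤ α) {s : ℝ} (hs : 0 ≤ s) :
    L * (α + 1) * ∫ σ in (0 : ℝ)..s, σ ^ α * expWeight L α σ = expWeight L α s - 1 := by
  have hc : Continuous fun σ : ℝ => σ ^ α * expWeight L α σ :=
    (continuous_id.rpow_const fun _ => Or.inr hα).mul (continuous_expWeight hα)
  have hc' : Continuous fun σ : ℝ => L * (α + 1) * (σ ^ α * expWeight L α σ) := by fun_prop
  rw [← intervalIntegral.integral_const_mul,
    intervalIntegral.integral_eq_sub_of_hasDerivAt_of_le hs (f := expWeight L α)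
      (continuous_expWeight hα).continuousOn _ (hc'.intervalIntegrable _ _)]
  · simp [expWeight, zero_rpow (by linarith : α + 1 ≠ 0)]
  · intro x hx
    have h1 : HasDerivAt (fun σ => exp (L * σ ^ (α + 1)))
        (exp (L * x ^ (α + 1)) * (L * ((α + 1) * x ^ (α + 1 - 1)))) x :=
      ((hasDerivAt_rpow_const (Or.inl hx.1.ne')).const_mul L).exp
    refine HasDerivAt.congr_deriv (h1.congr_of_eventuallyEq ?_) ?_
    · filter_upwards [lt_mem_nhds hx.1] with y hy
      rw [expWeight, max_eq_left hy.le]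
    · rw [expWeight, max_eq_left hx.1.le, add_sub_cancel_right]
      ring

section Family

variable {a : ℝ → ℝ} {κ α L : ℝ}

lemma pot_sub_le (ha : Continuous a) (ha0 : ∀ s, 0 ≤ a s) (hα : 0 ≤ α) (hκ : 0 ≤ κ) (hL : 0 ≤ L)
    (hbd : ∀ s, 0 ≤ s → a s ≤ κ * s ^ α) {U V : ℝ → ℝ} (hU : Continuous U) (hV : Continuous V)
    {D : ℝ} (hUV : ∀ s, |U s - V s| ≤ D * expWeight L α s) (s : ℝ) :
    |pot a U s - pot a V s| ≤
      D * κ * ∫ σ in (0 : ℝ)..max s 0, σ ^ α * expWeight L α σ := by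
  have hD : 0 ≤ D := nonneg_of_mul_nonneg_left ((abs_nonneg _).trans (hUV 0)) (expWeight_pos _ _ _)
  have cU := continuous_dens ha hU
  have cV := continuous_dens ha hV
  have hc : Continuous fun σ : ℝ => σ ^ α * expWeight L α σ :=
    (continuous_id.rpow_const fun _ => Or.inr hα).mul (continuous_expWeight hα)
  rw [pot, pot, ← intervalIntegral.integral_sub ((continuous_avg cU).intervalIntegrable _ _)
    ((continuous_avg cV).intervalIntegrable _ _), ← intervalIntegral.integral_const_mul]
  have key : ∀ ξ σ, 0 ≤ ξ → ξ ≤ σ →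
      |dens a U ξ - dens a V ξ| ≤ D * κ * (σ ^ α * expWeight L α σ) := fun ξ σ h0 h1 => by
    calc |dens a U ξ - dens a V ξ| ≤ a ξ * |U ξ - V ξ| := abs_dens_sub_le ha0 U V ξ
      _ ≤ (κ * ξ ^ α) * (D * expWeight L α ξ) :=
        mul_le_mul (hbd ξ h0) (hUV ξ) (abs_nonneg _) (by positivity)
      _ ≤ (κ * σ ^ α) * (D * expWeight L α σ) := by
        have := expWeight_mono hL hα h1
        have := (expWeight_pos L α ξ).le
        have : 0 ≤ σ := h0.trans h1
        gcongr
      _ = _ := by ring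
  refine (intervalIntegral.abs_integral_le_integral_abs (le_max_right _ _)).trans ?_
  refine intervalIntegral.integral_mono_on (le_max_right _ _)
    (((continuous_avg cU).sub (continuous_avg cV)).abs.intervalIntegrable _ _)
    ((by fun_prop : Continuous fun σ : ℝ => D * κ * (σ ^ α * expWeight L α σ)).intervalIntegrable
      _ _) fun σ hσ => ?_
  rw [abs_le]
  constructor
  · rw [neg_le, neg_sub, avg_sub cV cU]
    refine avg_le (cV.sub cU) hσ.1 fun ξ h0 h1 => ?_
    have := (abs_le.1 (key ξ σ h0 h1)).1
    linarith
  · rw [avg_sub cU cV]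
    exact avg_le (cU.sub cV) hσ.1 fun ξ h0 h1 => (abs_le.1 (key ξ σ h0 h1)).2

lemma pot_le (ha : Continuous a) (ha0 : ∀ s, 0 ≤ a s) (hα : 0 ≤ α) (hκ : 0 ≤ κ) (hL : 0 ≤ L)
    (hbd : ∀ s, 0 ≤ s → a s ≤ κ * s ^ α) {U : ℝ → ℝ} (hU : Continuous U) (s : ℝ) :
    pot a U s ≤ κ * ∫ σ in (0 : ℝ)..max s 0, σ ^ α * expWeight L α σ := by
  have cU := continuous_dens ha hU
  have hc : Continuous fun σ : ℝ => σ ^ α * expWeight L α σ :=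
    (continuous_id.rpow_const fun _ => Or.inr hα).mul (continuous_expWeight hα)
  rw [pot, ← intervalIntegral.integral_const_mul]
  refine intervalIntegral.integral_mono_on (le_max_right _ _)
    ((continuous_avg cU).intervalIntegrable _ _)
    ((by fun_prop : Continuous fun σ : ℝ => κ * (σ ^ α * expWeight L α σ)).intervalIntegrable
      _ _) fun σ hσ => avg_le cU hσ.1 fun ξ h0 h1 => ?_
  have h2 : 1 ≤ expWeight L α σ := one_le_exp (mul_nonneg hL (rpow_nonneg (le_max_right _ _) _))
  calc dens a U ξ ≤ κ * ξ ^ α := (dens_le ha0 U ξ).trans (hbd ξ h0)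
    _ ≤ κ * σ ^ α := by gcongr
    _ ≤ κ * (σ ^ α * expWeight L α σ) :=
      mul_le_mul_of_nonneg_left (le_mul_of_one_le_right (rpow_nonneg hσ.1 _) h2) hκ

/-- Global solutions of the integral equation for the potential, for all amplitudes in a bounded
interval, depending continuously on the amplitude. -/
theorem exists_potential_family (ha : Continuous a) (ha0 : ∀ s, 0 ≤ a s) (hα : 0 ≤ α) (hκ : 0 < κ)
    (hbd : ∀ s, 0 ≤ s → a s ≤ κ * s ^ α) {A₀ : ℝ} (hA₀ : 0 < A₀) :
    ∃ U : ℝ → ℝ → ℝ, (∀ A, Continuous (U A)) ∧ (∀ s, Continuous fun A => U A s) ∧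
      (∀ A s, 0 ≤ U A s) ∧ ∀ A ∈ Icc 0 A₀, ∀ s, 0 ≤ s →
        U A s = A * ∫ σ in (0 : ℝ)..s, avg (fun ξ => a ξ * exp (-U A ξ)) σ := by
  obtain ⟨L, hL, hLeq⟩ : ∃ L : ℝ, 0 < L ∧ L * (α + 1) = 2 * A₀ * κ :=
    ⟨2 * A₀ * κ / (α + 1), by positivity, by field_simp⟩
  set W := expWeight L α with hW
  have Wpos : ∀ s, 0 < W s := expWeight_pos L α
  have Wc : Continuous W := continuous_expWeight hα
  have Wint : ∀ s, κ * (∫ σ in (0 : ℝ)..max s 0, σ ^ α * W σ) ≤ W s / (2 * A₀) := fun s => by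
    have h1 := integral_rpow_mul_expWeight (L := L) hα (le_max_right s 0)
    have h2 : expWeight L α (max s 0) = W s := by simp [hW, expWeight]
    rw [h2, hLeq] at h1
    rw [le_div_iff₀ (by positivity)]
    linarith
  have potc : ∀ y : BoundedContinuousFunction ℝ ℝ, Continuous (pot a fun s => W s * y s) :=
    fun y => continuous_pot ha (by fun_prop)
  have pot_bd : ∀ (y : BoundedContinuousFunction ℝ ℝ) s,
      |pot a (fun s => W s * y s) s / W s| ≤ 1 / (2 * A₀) := fun y s => by
    rw [abs_of_nonneg (div_nonneg (pot_nonneg ha0 _ _) (Wpos s).le), div_le_iff₀ (Wpos s),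
      one_div_mul_eq_div]
    exact (pot_le ha ha0 hα hκ.le hL.le hbd (by fun_prop) s).trans (Wint s)
  set clamp : ℝ → ℝ := fun A => max 0 (min A A₀)
  have clampc : Continuous clamp := by fun_prop
  have clamp0 : ∀ A, 0 ≤ clamp A := fun A => le_max_left _ _
  have clampA : ∀ A, clamp A ≤ A₀ := fun A => max_le hA₀.le (min_le_right _ _)
  set T : ℝ → BoundedContinuousFunction ℝ ℝ → BoundedContinuousFunction ℝ ℝ := fun A y =>
    BoundedContinuousFunction.ofNormedAddCommGroup
      (fun s => clamp A * (pot a (fun s => W s * y s) s / W s))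
      (continuous_const.mul ((potc y).div Wc fun s => (Wpos s).ne')) (A₀ * (1 / (2 * A₀)))
      (fun s => by
        rw [norm_eq_abs, abs_mul, abs_of_nonneg (clamp0 A)]
        exact mul_le_mul (clampA A) (pot_bd y s) (abs_nonneg _) hA₀.le) with hT
  have contr : ∀ A, ContractingWith (1 / 2 : ℝ≥0) (T A) := fun A => by
    refine ⟨by norm_num [← NNReal.coe_lt_coe], LipschitzWith.of_dist_le_mul fun y z => ?_⟩
    rw [BoundedContinuousFunction.dist_le (by positivity)]
    intro s
    have h1 : |pot a (fun s => W s * y s) s - pot a (fun s => W s * z s) s| ≤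
        dist y z * (W s / (2 * A₀)) := by
      refine (pot_sub_le ha ha0 hα hκ.le hL.le hbd (by fun_prop) (by fun_prop) (D := dist y z)
        (fun s => ?_) s).trans ?_
      · rw [← mul_sub, abs_mul, abs_of_pos (Wpos s), mul_comm]
        refine mul_le_mul_of_nonneg_right ?_ (Wpos s).le
        rw [← Real.dist_eq]
        exact BoundedContinuousFunction.dist_coe_le_dist s
      · rw [mul_assoc]
        exact mul_le_mul_of_nonneg_left (Wint s) dist_nonneg
    simp only [hT, BoundedContinuousFunction.coe_ofNormedAddCommGroup, dist_eq_norm, norm_eq_abs]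
    rw [← mul_sub, ← sub_div, abs_mul, abs_div, abs_of_nonneg (clamp0 A), abs_of_pos (Wpos s),
      ← dist_eq_norm]
    calc clamp A * (|pot a (fun s => W s * y s) s - pot a (fun s => W s * z s) s| / W s)
        ≤ A₀ * (dist y z * (W s / (2 * A₀)) / W s) := by
          have := (Wpos s).le
          gcongr
          exact clampA A
      _ = ((1 / 2 : ℝ≥0) : ℝ) * dist y z := by
          have := (Wpos s).ne'
          push_cast
          field_simp
  set y : ℝ → BoundedContinuousFunction ℝ ℝ := fun A => (contr A).fixedPoint (T A)
  have hfix : ∀ A, T A (y A) = y A := fun A => (contr A).fixedPoint_isFixedPt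
  have ydist : ∀ A B, dist (y A) (y B) ≤
      |clamp A - clamp B| * (1 / (2 * A₀)) / (1 - (1 / 2 : ℝ≥0)) := fun A B => by
    refine (contr A).fixedPoint_lipschitz_in_map (contr B) fun z => ?_
    rw [BoundedContinuousFunction.dist_le (by positivity)]
    intro s
    simp only [hT, BoundedContinuousFunction.coe_ofNormedAddCommGroup, dist_eq_norm, norm_eq_abs]
    rw [← sub_mul, abs_mul]
    exact mul_le_mul_of_nonneg_left (pot_bd z s) (abs_nonneg _)
  have yc : Continuous y := by
    rw [continuous_iff_continuousAt]
    intro A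
    rw [ContinuousAt, tendsto_iff_dist_tendsto_zero]
    refine squeeze_zero (fun _ => dist_nonneg) (fun B => ydist B A) ?_
    have : Continuous fun B => |clamp B - clamp A| * (1 / (2 * A₀)) / (1 - (1 / 2 : ℝ≥0)) := by
      fun_prop
    simpa using this.tendsto A
  have hUeq : ∀ A s, W s * y A s = clamp A * pot a (fun s => W s * y A s) s := fun A s => by
    have h1 : y A s = clamp A * (pot a (fun s => W s * y A s) s / W s) := by
      conv_lhs => rw [← hfix A]
      rfl
    conv_lhs => rw [h1]
    have := (Wpos s).ne'
    field_simp
  have hU0 : ∀ A s, 0 ≤ W s * y A s := fun A s => by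
    rw [hUeq]
    exact mul_nonneg (clamp0 A) (pot_nonneg ha0 _ _)
  refine ⟨fun A s => W s * y A s, fun A => by fun_prop, fun s => ?_, hU0, fun A hA s hs => ?_⟩
  · exact continuous_const.mul ((continuous_eval_const s).comp yc)
  · have hcl : clamp A = A := by simp only [clamp]; rw [min_eq_left hA.2, max_eq_right hA.1]
    simp only
    conv_lhs => rw [hUeq, hcl, pot, max_eq_left hs]
    have hdens : (dens a fun s => W s * y A s) = fun ξ => a ξ * exp (-(W ξ * y A ξ)) := by
      funext ξ
      rw [dens, max_eq_right (hU0 A ξ)]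
    rw [hdens]

end Family

lemma isRadialFlow_of_integral_eq {a U : ℝ → ℝ} {A : ℝ} (ha : Continuous a) (hU : Continuous U)
    (hUeq : ∀ s, 0 ≤ s → U s = A * ∫ σ in (0 : ℝ)..s, avg (fun ξ => a ξ * exp (-U ξ)) σ) :
    IsRadialFlow a A U fun s => A * ∫ ξ in (0 : ℝ)..s, a ξ * exp (-U ξ) := by
  have hc : Continuous fun ξ => a ξ * exp (-U ξ) := by fun_prop
  have hflux : ∀ s, HasDerivAt (fun s => A * ∫ ξ in (0 : ℝ)..s, a ξ * exp (-U ξ))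
      (A * (a s * exp (-U s))) s := fun s => (hc.integral_hasStrictDerivAt 0 s).hasDerivAt.const_mul A
  refine ⟨fun s hs => ?_, fun s _ => hflux s, ?_, ?_⟩
  · have h1 := ((continuous_avg hc).integral_hasStrictDerivAt 0 s).hasDerivAt.const_mul A
    refine (h1.congr_of_eventuallyEq ?_).congr_deriv ?_
    · filter_upwards [lt_mem_nhds hs] with t ht
      exact hUeq t ht.le
    · rw [← mul_avg]
      field_simp
  · have h1 : Continuous fun s => A * ∫ ξ in (0 : ℝ)..s, a ξ * exp (-U ξ) :=
      continuous_iff_continuousAt.2 fun s => (hflux s).continuousAt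
    simpa using (h1.tendsto 0).mono_left nhdsWithin_le_nhds
  · have h1 : Continuous fun s => A * (s * a s * exp (-U s)) := by fun_prop
    simpa using (h1.tendsto 0).mono_left nhdsWithin_le_nhds

lemma exists_linear_defect_neg {a N : ℝ → ℝ} (hac : Continuous a) (ha : IsWeight a N)
    {c η S : ℝ} (hc : 0 < c) (hη : 0 < η) (hS : 0 < S) (hN : ∀ s, S < s → N s ≤ c - η) :
    ∃ T, S ≤ T ∧ T * a T - c * (∫ ξ in (0 : ℝ)..T, a ξ) < 0 := by
  by_contra! hcon
  set I : ℝ → ℝ := fun s => ∫ ξ in (0 : ℝ)..s, a ξ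
  have hI : ∀ s, HasDerivAt I (a s) s := fun s => (hac.integral_hasStrictDerivAt 0 s).hasDerivAt
  have hIS : 0 < I S := intervalIntegral.intervalIntegral_pos_of_pos_on
    (hac.intervalIntegrable _ _) (fun x hx => ha.pos x hx.1) hS
  have hImono : MonotoneOn I (Ici S) := monotoneOn_of_hasDerivAt (convex_Ici S)
    (fun s _ => hI s) fun s hs => (ha.pos s (hS.trans_le hs)).le
  have hanti : AntitoneOn (fun s => s * a s - c * I s + η * (c * I S) * log s) (Ioi S) := by
    refine antitoneOn_of_hasDerivAt (convex_Ioi S)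
      (f' := fun s => a s * N s - c * a s + η * (c * I S) * s⁻¹) (fun s hs =>
      ((ha.hasDerivAt s (hS.trans hs)).sub ((hI s).const_mul c)).add
        ((hasDerivAt_log (hS.trans hs).ne').const_mul _)) fun s hs => ?_
    have hs0 : 0 < s := hS.trans hs
    have h1 : c * I S * s⁻¹ ≤ a s := by
      rw [← div_eq_mul_inv, div_le_iff₀ hs0]
      nlinarith [hcon s (le_of_lt hs), hImono (mem_Ici.2 le_rfl) (mem_Ici.2 (le_of_lt hs))
        (le_of_lt hs)]
    nlinarith [hN s hs, ha.pos s hs0]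
  set k := η * (c * I S)
  have hk : 0 < k := by positivity
  obtain ⟨T, hT⟩ := ((tendsto_log_atTop.const_mul_atTop hk).eventually_gt_atTop
    ((S + 1) * a (S + 1) - c * I (S + 1) + k * log (S + 1))).and (eventually_ge_atTop (S + 1))
    |>.exists
  have h1 := hanti (mem_Ioi.2 (lt_add_one S)) (mem_Ioi.2 (by linarith [hT.2])) hT.2
  have h2 := hcon T (by linarith [hT.2])
  simp only at h1
  linarith [hT.1]

/-- Some amplitude produces a global radial flow with total flux exactly `2 * c`. -/
theorem exists_flow_of_total_flux {a N : ℝ → ℝ} {α κ b c δ η S : ℝ} (hac : Continuous a)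
    (ha : IsWeight a N) (ha0 : ∀ s, 0 ≤ a s) (hα : 0 ≤ α) (hκ : 0 < κ)
    (hbd : ∀ s, 0 ≤ s → a s ≤ κ * s ^ α) (hc : 0 < c) (hcb : c < b) (hδ : 0 < δ)
    (hNδ : ∀ s, 0 < s → s ≤ δ → b ≤ N s) (hη : 0 < η) (hS : 0 < S)
    (hNS : ∀ s, S < s → N s ≤ c - η) :
    ∃ (A : ℝ) (U : ℝ → ℝ), 0 < A ∧ Continuous U ∧
      (∀ s, 0 ≤ s → U s = A * ∫ σ in (0 : ℝ)..s, avg (fun ξ => a ξ * exp (-U ξ)) σ) ∧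
      Tendsto (fun s => A * ∫ ξ in (0 : ℝ)..s, a ξ * exp (-U ξ)) atTop (𝓝 (2 * c)) := by
  have hI : ∀ s, 0 < s → HasDerivAt (fun s => ∫ ξ in (0 : ℝ)..s, a ξ) (a s) s := fun s _ =>
    (hac.integral_hasStrictDerivAt 0 s).hasDerivAt
  have hI0 : Tendsto (fun s => ∫ ξ in (0 : ℝ)..s, a ξ) (𝓝[>] 0) (𝓝 0) := by
    have h1 := intervalIntegral.continuous_primitive (μ := volume)
      (fun x y => hac.intervalIntegrable x y) 0
    simpa using (h1.tendsto 0).mono_left nhdsWithin_le_nhds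
  have hIδ : 0 < ∫ ξ in (0 : ℝ)..δ, a ξ := intervalIntegral.intervalIntegral_pos_of_pos_on
    (hac.intervalIntegrable _ _) (fun x hx => ha.pos x hx.1) hδ
  set J := exp (-(2 * c / (b - c))) * ∫ ξ in (0 : ℝ)..δ, a ξ with hJ
  have hJ0 : 0 < J := by positivity
  set A₀ := (2 * c + 1) / J
  have hA₀ : 0 < A₀ := by positivity
  have hlarge : 2 * c < A₀ * exp (-(2 * c / (b - c))) * ∫ ξ in (0 : ℝ)..δ, a ξ := by
    rw [mul_assoc, ← hJ, div_mul_cancel₀ _ hJ0.ne']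
    linarith
  obtain ⟨U, hUc, hUA, hU0, hUeq⟩ := exists_potential_family hac ha0 hα hκ hbd hA₀
  by_contra! hcon
  set μ : ℝ → ℝ → ℝ := fun A s => ∫ ξ in (0 : ℝ)..s, a ξ * exp (-U A ξ) with hμ
  have hflow : ∀ A ∈ Icc 0 A₀, IsRadialFlow a A (U A) fun s => A * μ A s := fun A hA =>
    isRadialFlow_of_integral_eq hac (hUc A) (hUeq A hA)
  have hμA : ∀ s, Continuous fun A => μ A s := fun s => by
    refine intervalIntegral.continuous_of_dominated_interval (bound := a)
      (fun A => ?_) (fun A => ?_) (hac.intervalIntegrable _ _) ?_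
    · have := hUc A
      exact (by fun_prop : Continuous fun ξ => a ξ * exp (-U A ξ)).aestronglyMeasurable
    · refine Eventually.of_forall fun ξ _ => ?_
      rw [norm_eq_abs, abs_of_nonneg (mul_nonneg (ha0 ξ) (exp_pos _).le)]
      exact mul_le_of_le_one_right (ha0 ξ) (exp_le_one_iff.2 (neg_nonpos.2 (hU0 A ξ)))
    · refine Eventually.of_forall fun ξ _ => ?_
      have := hUA ξ
      fun_prop
  set G : ℝ → ℝ → ℝ := fun T A =>
    T * a T * exp (-U A T) - μ A T * (2 * c - A * μ A T) / 2 with hG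
  have hGc : ∀ T, Continuous (G T) := fun T => by
    have := hUA T
    have := hμA T
    fun_prop
  have hdefect : ∀ A T, IsRadialFlow.defect a A (U A) (fun s => A * μ A s) c T = A * G T A := fun A T => by
    simp only [IsRadialFlow.defect, rate, hG]
    ring
  set P : Set ℝ := ⋃ s ∈ Ioi (0 : ℝ), {A | 2 * c < A * μ A s} with hP
  set Q : Set ℝ := ⋃ T ∈ Ici S, {A | G T A < 0} ∩ {A | A * μ A T < 2 * c} with hQ
  have hPo : IsOpen P := isOpen_biUnion fun s _ =>
    isOpen_lt continuous_const (continuous_id.mul (hμA s))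
  have hQo : IsOpen Q := isOpen_biUnion fun T _ =>
    (isOpen_lt (hGc T) continuous_const).inter
      (isOpen_lt (continuous_id.mul (hμA T)) continuous_const)
  have h0Q : (0 : ℝ) ∈ Q := by
    obtain ⟨T, hST, hT⟩ := exists_linear_defect_neg hac ha hc hη hS hNS
    have hU00 : ∀ s, 0 ≤ s → U 0 s = 0 := fun s hs => by
      rw [hUeq 0 ⟨le_rfl, hA₀.le⟩ s hs, zero_mul]
    have hT0 : 0 ≤ T := hS.le.trans hST
    have hμ0 : μ 0 T = ∫ ξ in (0 : ℝ)..T, a ξ := by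
      refine intervalIntegral.integral_congr fun ξ hξ => ?_
      rw [uIcc_of_le hT0] at hξ
      simp [hU00 ξ hξ.1]
    refine mem_iUnion₂.2 ⟨T, hST, ?_, ?_⟩
    · simp only [hG, mem_ofPred_eq, hμ0, hU00 T hT0]
      simp only [neg_zero, exp_zero]
      linarith
    · simp only [mem_ofPred_eq]
      linarith
  have hA₀P : A₀ ∈ P := mem_iUnion₂.2 ⟨δ, hδ, by
    have hmem : A₀ ∈ Icc 0 A₀ := ⟨hA₀.le, le_rfl⟩
    refine (hflow A₀ hmem).flux_gt_of_amplitude ha hA₀ ?_ hcb hδ hNδ hI hI0 hlarge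
    have h1 := ((hUc A₀).tendsto 0).mono_left (nhdsWithin_le_nhds (s := Ioi 0))
    rwa [hUeq A₀ hmem 0 le_rfl, intervalIntegral.integral_same, mul_zero] at h1⟩
  have hNS' : ∀ s, S < s → N s < c := fun s hs => (hNS s hs).trans_lt (by linarith)
  have hcover : Icc 0 A₀ ⊆ P ∪ Q := fun A hA => by
    rcases hA.1.eq_or_lt with rfl | hpos
    · exact Or.inr h0Q
    rcases (hflow A hA).trichotomy ha hpos hS hNS' with h | ⟨s, hs, h⟩ | ⟨T, hT, h1, h2⟩
    · exact absurd h (hcon A (U A) hpos (hUc A) (hUeq A hA))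
    · exact Or.inl (mem_iUnion₂.2 ⟨s, hs, h⟩)
    · refine Or.inr (mem_iUnion₂.2 ⟨T, hT, ?_, h2⟩)
      rw [hdefect] at h1
      exact neg_of_mul_neg_right h1 hpos.le
  obtain ⟨A, hA, hAP, hAQ⟩ := isPreconnected_Icc P Q hPo hQo hcover
    ⟨A₀, ⟨hA₀.le, le_rfl⟩, hA₀P⟩ ⟨0, ⟨le_rfl, hA₀.le⟩, h0Q⟩
  obtain ⟨s, hs, hAs⟩ := mem_iUnion₂.1 hAP
  obtain ⟨T, hT, hGT, hmT⟩ := mem_iUnion₂.1 hAQ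
  simp only [mem_ofPred_eq] at hAs hGT hmT
  have hpos : 0 < A := by
    rcases hA.1.eq_or_lt with rfl | h
    · linarith
    · exact h
  have hT0 : 0 < T := hS.trans_le hT
  exact absurd ((hflow A hA).flux_le_of_defect_neg ha hpos hT0
    (fun s h => hNS' s (lt_of_le_of_lt hT h))
    (by rw [hdefect]; exact mul_neg_of_pos_of_neg hpos hGT) hmT hs) hAs.not_gt

/-- The weight of the spherical Onsager equation in the variable `s = ‖x‖ ^ 2`. -/
def sphereWeight (l γ α s : ℝ) : ℝ :=
  (max s 0) ^ α * ((1 + max s 0) ^ l * exp (2 * γ / (1 + max s 0)))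

/-- The logarithmic derivative `s * (log (s * sphereWeight l γ α s))'`. -/
def sphereRate (l γ α s : ℝ) : ℝ := 1 + α + l * s / (1 + s) - 2 * γ * s / (1 + s) ^ 2

section Weight

variable {l γ α : ℝ}

lemma sphereWeight_of_nonneg {s : ℝ} (hs : 0 ≤ s) :
    sphereWeight l γ α s = s ^ α * ((1 + s) ^ l * exp (2 * γ / (1 + s))) := by
  rw [sphereWeight, max_eq_left hs]

lemma continuous_sphereWeight (hα : 0 ≤ α) : Continuous (sphereWeight l γ α) := by
  have h1 : Continuous fun s : ℝ => max s 0 := by fun_prop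
  have h2 : ∀ s : ℝ, 1 + max s 0 ≠ 0 := fun s => by positivity
  exact (h1.rpow_const fun _ => Or.inr hα).mul
    (((continuous_const.add h1).rpow_const fun s => Or.inl (h2 s)).mul
      (continuous_const.div (continuous_const.add h1) h2).rexp)

lemma sphereWeight_nonneg (s : ℝ) : 0 ≤ sphereWeight l γ α s := by
  unfold sphereWeight
  positivity

lemma sphereWeight_le (hl : l < 0) (hγ : 0 ≤ γ) {s : ℝ} (hs : 0 ≤ s) :
    sphereWeight l γ α s ≤ exp (2 * γ) * s ^ α := by
  rw [sphereWeight_of_nonneg hs, mul_comm]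
  refine mul_le_mul_of_nonneg_right ?_ (by positivity)
  have h1 : (1 + s) ^ l ≤ 1 := rpow_le_one_of_one_le_of_nonpos (by linarith) hl.le
  have h2 : exp (2 * γ / (1 + s)) ≤ exp (2 * γ) :=
    exp_le_exp.2 (div_le_self (by positivity) (by linarith))
  exact (mul_le_of_le_one_left (exp_pos _).le h1).trans h2

lemma isWeight_sphereWeight : IsWeight (sphereWeight l γ α) (sphereRate l γ α) := by
  refine ⟨fun s hs => ?_, fun s hs => ?_⟩
  · rw [sphereWeight_of_nonneg hs.le]
    positivity
  · have hs1 : 0 < 1 + s := by linarith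
    have e1 : HasDerivAt (fun s : ℝ => 1 + s) 1 s := (hasDerivAt_id s).const_add 1
    have h1 : HasDerivAt (fun s : ℝ => s ^ α) (α * s ^ (α - 1)) s :=
      hasDerivAt_rpow_const (Or.inl hs.ne')
    have h2 : HasDerivAt (fun s : ℝ => (1 + s) ^ l) (1 * l * (1 + s) ^ (l - 1)) s :=
      e1.rpow_const (Or.inl hs1.ne')
    have h3 : HasDerivAt (fun s : ℝ => exp (2 * γ / (1 + s)))
        (exp (2 * γ / (1 + s)) * ((0 * (1 + s) - 2 * γ * 1) / (1 + s) ^ 2)) s :=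
      ((hasDerivAt_const s (2 * γ)).div e1 hs1.ne').exp
    refine (((hasDerivAt_id s).mul (h1.mul (h2.mul h3))).congr_of_eventuallyEq ?_).congr_deriv ?_
    · filter_upwards [lt_mem_nhds hs] with t ht
      simp only [sphereWeight_of_nonneg ht.le, Pi.mul_apply, id]
    · simp only [sphereWeight_of_nonneg hs.le, sphereRate, Pi.mul_apply, id, rpow_sub_one hs.ne',
        rpow_sub_one hs1.ne']
      field_simp
      ring

lemma exists_sphereRate_sign_change {c : ℝ} (h1 : 1 + α + l < c) (h2 : c < 1 + α) :
    ∃ S, 0 < S ∧ (∀ s, 0 < s → s < S → c < sphereRate l γ α s) ∧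
      ∀ s, S < s → sphereRate l γ α s < c := by
  obtain ⟨p, hp⟩ : ∃ p, p = c - (1 + α + l) := ⟨_, rfl⟩
  obtain ⟨c₀, hc₀⟩ : ∃ c₀, c₀ = 1 + α - c := ⟨_, rfl⟩
  obtain ⟨q, hq⟩ : ∃ q, q = 2 * c₀ + l - 2 * γ := ⟨_, rfl⟩
  have hp0 : 0 < p := by linarith
  have hc0 : 0 < c₀ := by linarith
  obtain ⟨S, hS, hroot⟩ : ∃ S, 0 < S ∧ -p * S ^ 2 + q * S + c₀ = 0 := by
    have hsq : sqrt (q ^ 2 + 4 * p * c₀) ^ 2 = q ^ 2 + 4 * p * c₀ := sq_sqrt (by positivity)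
    have hlt : |q| < sqrt (q ^ 2 + 4 * p * c₀) :=
      lt_sqrt_of_sq_lt (by rw [sq_abs]; linarith [mul_pos hp0 hc0])
    generalize sqrt (q ^ 2 + 4 * p * c₀) = w at hsq hlt
    refine ⟨(q + w) / (2 * p), div_pos (by linarith [neg_abs_le q]) (by positivity), ?_⟩
    field_simp
    linarith
  have key : ∀ s, 0 < s → (sphereRate l γ α s - c) * ((1 + s) ^ 2 * S) =
      (S - s) * (c₀ + p * s * S) := fun s hs => by
    have hs1 : 1 + s ≠ 0 := by positivity
    have h3 : (sphereRate l γ α s - c) * (1 + s) ^ 2 = -p * s ^ 2 + q * s + c₀ := by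
      rw [sphereRate, hq, hp, hc₀]
      field_simp
      ring
    rw [← mul_assoc, h3]
    linear_combination s * hroot
  refine ⟨S, hS, fun s hs hsS => ?_, fun s hs => ?_⟩
  · have h3 : 0 < (sphereRate l γ α s - c) * ((1 + s) ^ 2 * S) := by
      rw [key s hs]
      exact mul_pos (sub_pos.2 hsS) (by positivity)
    exact sub_pos.1 (pos_of_mul_pos_left h3 (by positivity))
  · have hs0 := hS.trans hs
    have h3 : (sphereRate l γ α s - c) * ((1 + s) ^ 2 * S) < 0 := by
      rw [key s hs0]
      exact mul_neg_of_neg_of_pos (sub_neg.2 hs) (by positivity)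
    exact sub_neg.1 (neg_of_mul_neg_left h3 (by positivity))

lemma sphereRate_ge (hl : l < 0) (hγ : 0 ≤ γ) {s : ℝ} (hs : 0 ≤ s) :
    1 + α - (2 * γ - l) * s ≤ sphereRate l γ α s := by
  have h1 : -l * s / (1 + s) ≤ -l * s := div_le_self (by nlinarith) (by linarith)
  have h2 : 2 * γ * s / (1 + s) ^ 2 ≤ 2 * γ * s := div_le_self (by positivity) (by nlinarith)
  rw [neg_mul, neg_div] at h1
  rw [sphereRate]
  linarith

lemma sphereRate_le (hγ : 0 ≤ γ) {s : ℝ} (hs : 0 ≤ s) :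
    sphereRate l γ α s ≤ 1 + α + l - l / (1 + s) := by
  have h1 : 0 ≤ 2 * γ * s / (1 + s) ^ 2 := by positivity
  have h2 : l * s / (1 + s) = l - l / (1 + s) := by
    have : 1 + s ≠ 0 := by positivity
    field_simp
    ring
  rw [sphereRate, h2]
  linarith

lemma abs_sphereRate_le (hl : l < 0) (hγ : 0 ≤ γ) (hα : 0 ≤ α) {s : ℝ} (hs : 0 ≤ s) :
    |sphereRate l γ α s| ≤ 1 + α + 2 * γ - l := by
  have h1 : l * s / (1 + s) ≤ 0 := div_nonpos_of_nonpos_of_nonneg (by nlinarith) (by linarith)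
  have h2 : l ≤ l * s / (1 + s) := by
    rw [le_div_iff₀ (by linarith)]
    nlinarith
  have h3 : 0 ≤ 2 * γ * s / (1 + s) ^ 2 := by positivity
  have h4 : 2 * γ * s / (1 + s) ^ 2 ≤ 2 * γ := by
    rw [div_le_iff₀ (by positivity)]
    nlinarith [mul_nonneg hγ hs, mul_nonneg (mul_nonneg hγ hs) hs]
  rw [sphereRate, abs_le]
  constructor <;> linarith

/-- The radial equation on the sphere has a global solution with total flux `β`. -/
theorem exists_sphere_flow {β : ℝ} (hα : 0 ≤ α) (hl : l < 0) (hγ : 0 ≤ γ) (hβ : 0 < β)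
    (h1 : 1 + α + l < β / 2) (h2 : β / 2 < 1 + α) :
    ∃ (A : ℝ) (U : ℝ → ℝ), 0 < A ∧ Continuous U ∧
      (∀ s, 0 ≤ s → U s =
        A * ∫ σ in (0 : ℝ)..s, avg (fun ξ => sphereWeight l γ α ξ * exp (-U ξ)) σ) ∧
      Tendsto (fun s => A * ∫ ξ in (0 : ℝ)..s, sphereWeight l γ α ξ * exp (-U ξ))
        atTop (𝓝 β) := by
  have hd : 0 < 2 * γ - l := by linarith
  have hη : 0 < (β / 2 - (1 + α + l)) / 2 := by linarith
  have hc : 0 < (1 + α - β / 2) / 2 := by linarith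
  have hNδ : ∀ s, 0 < s → s ≤ (1 + α - β / 2) / 2 / (2 * γ - l) →
      1 + α - (1 + α - β / 2) / 2 ≤ sphereRate l γ α s := fun s hs hsδ => by
    rw [le_div_iff₀ hd] at hsδ
    linarith [sphereRate_ge (α := α) hl hγ hs.le]
  have hS : 0 < -l / ((β / 2 - (1 + α + l)) / 2) := div_pos (by linarith) hη
  have hNS : ∀ s, -l / ((β / 2 - (1 + α + l)) / 2) < s →
      sphereRate l γ α s ≤ β / 2 - (β / 2 - (1 + α + l)) / 2 := fun s hs => by
    have hs0 : 0 < s := hS.trans hs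
    rw [div_lt_iff₀ hη] at hs
    have h3 : -l / (1 + s) ≤ (β / 2 - (1 + α + l)) / 2 := by
      rw [div_le_iff₀ (by linarith)]
      linarith
    rw [neg_div] at h3
    linarith [sphereRate_le (l := l) (α := α) hγ hs0.le]
  obtain ⟨A, U, hA, hU, hUeq, hlim⟩ := exists_flow_of_total_flux (a := sphereWeight l γ α)
    (continuous_sphereWeight hα) isWeight_sphereWeight sphereWeight_nonneg hα (exp_pos (2 * γ))
    (fun s hs => sphereWeight_le hl hγ hs) (half_pos hβ) (by linarith) (by positivity) hNδ hη hS hNS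
  exact ⟨A, U, hA, hU, hUeq, by rwa [mul_div_cancel₀ β two_ne_zero] at hlim⟩

end Weight

lemma hasFDerivAt_comp_norm_sq {F : ℝ → ℝ} {F' : ℝ} {x : R2} (h : HasDerivAt F F' (‖x‖ ^ 2)) :
    HasFDerivAt (fun y : R2 => F (‖y‖ ^ 2)) (innerSL ℝ ((2 * F') • x)) x := by
  refine (h.comp_hasFDerivAt x (hasStrictFDerivAt_norm_sq x).hasFDerivAt).congr_fderiv ?_
  ext v
  simp
  ring

lemma lap_eq_sum_of_hasFDerivAt {ψ : R2 → ℝ} {V : R2 → R2} {V' : R2 →L[ℝ] R2} {x : R2}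
    (h : ∀ᶠ y in 𝓝 x, HasFDerivAt ψ (innerSL ℝ (V y)) y) (hV : HasFDerivAt V V' x) :
    lap ψ x = ∑ i, V' (EuclideanSpace.single i 1) i := by
  have h1 : HasFDerivAt (fderiv ℝ ψ) ((innerSL ℝ).comp V') x :=
    ((innerSL ℝ (E := R2)).hasFDerivAt.comp x hV).congr_of_eventuallyEq
      (h.mono fun y hy => hy.fderiv)
  simp only [lap, iteratedFDeriv_two_apply, h1.fderiv]
  refine Finset.sum_congr rfl fun i _ => ?_
  simp [EuclideanSpace.inner_single_right]

/-- The derivative at `x` of `y ↦ f (‖y‖ ^ 2) • y`, where `p = ‖x‖ ^ 2 * f' (‖x‖ ^ 2)`. -/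
def radialDeriv (f p : ℝ) (x : R2) : R2 →L[ℝ] R2 :=
  f • ContinuousLinearMap.id ℝ R2 + (2 * (p / ‖x‖ ^ 2)) • (innerSL ℝ x).smulRight x

lemma radialDeriv_zero (f p : ℝ) : radialDeriv f p 0 = f • ContinuousLinearMap.id ℝ R2 := by
  simp [radialDeriv]

lemma sum_radialDeriv (f p : ℝ) {x : R2} (hx : x ≠ 0) :
    ∑ i, radialDeriv f p x (EuclideanSpace.single i 1) i = 2 * f + 2 * p := by
  have h1 : x 0 ^ 2 + x 1 ^ 2 = ‖x‖ ^ 2 := by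
    rw [EuclideanSpace.real_norm_sq_eq, Fin.sum_univ_two]
  have h2 : ‖x‖ ^ 2 ≠ 0 := by positivity
  simp only [radialDeriv, Fin.sum_univ_two]
  simp [EuclideanSpace.inner_single_right]
  field_simp
  linear_combination 2 * p * h1

lemma hasFDerivAt_smul_self {f : ℝ → ℝ} {f' : ℝ} {x : R2} (hx : x ≠ 0)
    (hf : HasDerivAt f f' (‖x‖ ^ 2)) :
    HasFDerivAt (fun y : R2 => f (‖y‖ ^ 2) • y) (radialDeriv (f (‖x‖ ^ 2)) (‖x‖ ^ 2 * f') x) x := by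
  have h2 : ‖x‖ ^ 2 ≠ 0 := by positivity
  refine ((hasFDerivAt_comp_norm_sq hf).smul (hasFDerivAt_id x)).congr_fderiv ?_
  ext1 v
  simp only [radialDeriv, mul_div_cancel_left₀ _ h2]
  simp [smul_smul]

/-- The Laplacian of a radial function in terms of the variable `s = ‖x‖ ^ 2`. -/
lemma lap_comp_norm_sq {F f : ℝ → ℝ} {f' : ℝ} {x : R2} (hx : x ≠ 0)
    (hF : ∀ s, 0 < s → HasDerivAt F (f s) s) (hf : HasDerivAt f f' (‖x‖ ^ 2)) :
    lap (fun y => F (‖y‖ ^ 2)) x = 4 * (f (‖x‖ ^ 2) + ‖x‖ ^ 2 * f') := by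
  have h1 : ∀ᶠ y in 𝓝 x,
      HasFDerivAt (fun y : R2 => F (‖y‖ ^ 2)) (innerSL ℝ ((2 * f (‖y‖ ^ 2)) • y)) y := by
    filter_upwards [isOpen_ne.mem_nhds hx] with y hy
    exact hasFDerivAt_comp_norm_sq (hF _ (by have : y ≠ 0 := hy; positivity))
  rw [lap_eq_sum_of_hasFDerivAt h1 (hasFDerivAt_smul_self hx (hf.const_mul 2)),
    sum_radialDeriv _ _ hx]
  ring

section Potential

variable {e : ℝ → ℝ}

lemma hasDerivAt_avg (he : Continuous e) {s : ℝ} (hs : s ≠ 0) :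
    HasDerivAt (avg e) ((e s - avg e s) / s) s := by
  have h1 : HasDerivAt (fun σ => (∫ ξ in (0 : ℝ)..σ, e ξ) / σ)
      ((e s * s - (∫ ξ in (0 : ℝ)..s, e ξ) * 1) / s ^ 2) s :=
    (he.integral_hasStrictDerivAt 0 s).hasDerivAt.div (hasDerivAt_id s) hs
  refine (h1.congr_of_eventuallyEq ?_).congr_deriv ?_
  · filter_upwards [isOpen_ne.mem_nhds hs] with σ hσ
    rw [← mul_avg, mul_div_cancel_left₀ _ hσ]
  · rw [← mul_avg]
    field_simp

lemma avg_zero (e : ℝ → ℝ) : avg e 0 = e 0 := by simp [avg]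

lemma hasFDerivAt_avg_smul_self (he : Continuous e) (x : R2) :
    HasFDerivAt (fun y : R2 => avg e (‖y‖ ^ 2) • y)
      (radialDeriv (avg e (‖x‖ ^ 2)) (e (‖x‖ ^ 2) - avg e (‖x‖ ^ 2)) x) x := by
  rcases eq_or_ne x 0 with rfl | hx
  · rw [radialDeriv_zero, hasFDerivAt_iff_isLittleO_nhds_zero]
    have hc : Continuous fun y : R2 => avg e (‖y‖ ^ 2) - avg e (‖(0 : R2)‖ ^ 2) :=
      ((continuous_avg he).comp (by fun_prop)).sub continuous_const
    have h1 : (fun y : R2 => avg e (‖y‖ ^ 2) - avg e (‖(0 : R2)‖ ^ 2)) =o[𝓝 0]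
        fun _ => (1 : ℝ) := by
      rw [Asymptotics.isLittleO_one_iff]
      simpa using hc.tendsto 0
    refine (h1.smul_isBigO (Asymptotics.isBigO_refl (fun y : R2 => y) (𝓝 0))).congr
      (fun y => ?_) (fun y => one_smul ℝ y)
    simp [sub_smul]
  · have hs : ‖x‖ ^ 2 ≠ 0 := by positivity
    have h1 := hasFDerivAt_smul_self hx (hasDerivAt_avg he hs)
    rwa [mul_div_cancel₀ _ hs] at h1

lemma continuous_radialDeriv_avg (he : Continuous e) : Continuous fun x : R2 =>
    radialDeriv (avg e (‖x‖ ^ 2)) (e (‖x‖ ^ 2) - avg e (‖x‖ ^ 2)) x := by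
  have hq : Continuous fun x : R2 => avg e (‖x‖ ^ 2) := (continuous_avg he).comp (by fun_prop)
  have hp : Continuous fun x : R2 => e (‖x‖ ^ 2) - avg e (‖x‖ ^ 2) := by fun_prop
  have hT : Continuous fun x : R2 => (innerSL ℝ x).smulRight x := by
    have h1 : Continuous fun x : R2 => innerSL ℝ x := (innerSL ℝ (E := R2)).continuous
    exact ((ContinuousLinearMap.smulRightL ℝ R2 R2).continuous.comp h1).clm_apply continuous_id
  refine (hq.smul continuous_const).add (continuous_iff_continuousAt.2 fun x => ?_)
  rcases eq_or_ne x 0 with rfl | hx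
  · rw [ContinuousAt, norm_zero]
    simp only [map_zero, ContinuousLinearMap.smulRight_zero, smul_zero]
    refine squeeze_zero_norm (a := fun x : R2 => 2 * |e (‖x‖ ^ 2) - avg e (‖x‖ ^ 2)|)
      (fun x => ?_) ?_
    · rw [norm_smul, ContinuousLinearMap.norm_smulRight_apply, innerSL_apply_norm, norm_mul,
        norm_div, norm_pow, norm_norm, norm_two, norm_eq_abs]
      rcases eq_or_ne x 0 with rfl | hx
      · simp
      · have : ‖x‖ ≠ 0 := norm_ne_zero_iff.2 hx
        refine le_of_eq ?_
        field_simp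
    · have h1 : Continuous fun x : R2 => 2 * |e (‖x‖ ^ 2) - avg e (‖x‖ ^ 2)| := by fun_prop
      simpa [avg_zero] using h1.tendsto 0
  · have hs : ‖x‖ ^ 2 ≠ 0 := by positivity
    have h1 : ContinuousAt (fun x : R2 => ‖x‖ ^ 2) x := by fun_prop
    exact ((hp.continuousAt.div h1 hs).const_mul 2).smul hT.continuousAt

lemma hasDerivAt_radial_potential (he : Continuous e) (C s : ℝ) :
    HasDerivAt (fun s => C - ∫ σ in (0 : ℝ)..s, avg e σ) (-avg e s) s :=
  (((continuous_avg he).integral_hasStrictDerivAt 0 s).hasDerivAt).const_sub C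

lemma hasFDerivAt_radial_potential (he : Continuous e) (C : ℝ) (x : R2) :
    HasFDerivAt (fun x : R2 => C - ∫ σ in (0 : ℝ)..‖x‖ ^ 2, avg e σ)
      (innerSL ℝ ((-2 : ℝ) • avg e (‖x‖ ^ 2) • x)) x := by
  have h1 := hasFDerivAt_comp_norm_sq (x := x) (hasDerivAt_radial_potential he C (‖x‖ ^ 2))
  rwa [show (2 * -avg e (‖x‖ ^ 2)) • x = (-2 : ℝ) • avg e (‖x‖ ^ 2) • x by
    rw [smul_smul]; ring_nf] at h1

theorem contDiff_radial_potential (he : Continuous e) (C : ℝ) :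
    ContDiff ℝ 2 fun x : R2 => C - ∫ σ in (0 : ℝ)..‖x‖ ^ 2, avg e σ := by
  have h1 : ContDiff ℝ 1 fun x : R2 => avg e (‖x‖ ^ 2) • x :=
    contDiff_one_iff_hasFDerivAt.2
      ⟨_, continuous_radialDeriv_avg he, hasFDerivAt_avg_smul_self he⟩
  refine (contDiff_succ_iff_hasFDerivAt (n := 1)).2
    ⟨_, ?_, hasFDerivAt_radial_potential he C⟩
  exact (innerSL ℝ (E := R2)).contDiff.comp (h1.const_smul (-2 : ℝ))

theorem lap_radial_potential (he : Continuous e) (C : ℝ) (x : R2) :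
    lap (fun x : R2 => C - ∫ σ in (0 : ℝ)..‖x‖ ^ 2, avg e σ) x = -4 * e (‖x‖ ^ 2) := by
  rw [lap_eq_sum_of_hasFDerivAt (Eventually.of_forall (hasFDerivAt_radial_potential he C))
    ((hasFDerivAt_avg_smul_self he x).const_smul (-2 : ℝ))]
  have h1 : ∀ f p : ℝ, ∑ i, ((-2 : ℝ) • radialDeriv f p x) (EuclideanSpace.single i 1) i =
      -2 * ∑ i, radialDeriv f p x (EuclideanSpace.single i 1) i := fun f p => by
    rw [Finset.mul_sum]
    rfl
  rw [h1]
  rcases eq_or_ne x 0 with rfl | hx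
  · rw [radialDeriv_zero]
    simp [avg_zero]
    ring
  · rw [sum_radialDeriv _ _ hx]
    ring

end Potential

lemma integral_comp_norm (g : ℝ → ℝ) :
    ∫ x : R2, g ‖x‖ = 2 * π * ∫ r in Ioi (0 : ℝ), r * g r := by
  have hdim : Module.finrank ℝ R2 = 2 := by simp
  have hball : (volume : Measure R2).real (ball 0 1) = π := by
    rw [Measure.real, InnerProductSpace.volume_ball_of_dim_even (k := 1) (by simp)]
    simp [pi_nonneg]
  rw [integral_fun_norm_addHaar, hdim, hball]
  simp [mul_assoc]

section Flux

variable {e m : ℝ → ℝ} {β : ℝ}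

lemma hasDerivAt_half_comp_sq (hm : ∀ s, 0 < s → HasDerivAt m (e s) s) {r : ℝ} (hr : r ∈ Ioi 0) :
    HasDerivAt (fun r => m (r ^ 2) / 2) (r * e (r ^ 2)) r := by
  have h1 : HasDerivAt (fun r : ℝ => r ^ 2) (2 * r) r := by simpa using hasDerivAt_pow 2 r
  have h2 : HasDerivAt m (e (r ^ 2)) (r ^ 2) := hm _ (pow_pos hr 2)
  exact ((HasDerivAt.comp (h := fun r : ℝ => r ^ 2) r h2 h1).div_const 2).congr_deriv (by ring)

lemma continuousWithinAt_half_comp_sq (hmc : ContinuousAt m 0) :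
    ContinuousWithinAt (fun r => m (r ^ 2) / 2) (Ici 0) 0 := by
  have h1 : ContinuousAt m ((0 : ℝ) ^ 2) := by simpa using hmc
  exact ((ContinuousAt.comp (f := fun r : ℝ => r ^ 2) h1 (by fun_prop)).div_const
    2).continuousWithinAt

lemma integral_of_tendsto_flux (he : ∀ s, 0 < s → 0 ≤ e s)
    (hm : ∀ s, 0 < s → HasDerivAt m (e s) s) (hm0 : m 0 = 0) (hmc : ContinuousAt m 0)
    (hlim : Tendsto m atTop (𝓝 β)) : ∫ x : R2, e (‖x‖ ^ 2) = π * β := by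
  have hlim' : Tendsto (fun r => m (r ^ 2) / 2) atTop (𝓝 (β / 2)) :=
    (hlim.comp (tendsto_pow_atTop two_ne_zero)).div_const 2
  have hint := integrableOn_Ioi_deriv_of_nonneg (continuousWithinAt_half_comp_sq hmc)
    (fun r hr => hasDerivAt_half_comp_sq hm hr)
    (fun r hr => mul_nonneg (le_of_lt hr) (he _ (pow_pos hr 2))) hlim'
  rw [integral_comp_norm fun r => e (r ^ 2),
    integral_Ioi_of_hasDerivAt_of_tendsto (continuousWithinAt_half_comp_sq hmc)
      (fun r hr => hasDerivAt_half_comp_sq hm hr) hint hlim']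
  simp [hm0]
  ring

lemma tendsto_flux_of_integral (hm : ∀ s, 0 < s → HasDerivAt m (e s) s) (hm0 : m 0 = 0)
    (hmc : ContinuousAt m 0) (hβ : β ≠ 0) (h : ∫ x : R2, e (‖x‖ ^ 2) = π * β) :
    Tendsto m atTop (𝓝 β) := by
  rw [integral_comp_norm fun r => e (r ^ 2)] at h
  have hval : ∫ r in Ioi (0 : ℝ), r * e (r ^ 2) = β / 2 :=
    mul_left_cancel₀ two_pi_pos.ne' (h.trans (by ring))
  have hint : IntegrableOn (fun r => r * e (r ^ 2)) (Ioi (0 : ℝ)) := by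
    by_contra hcon
    rw [integral_undef hcon] at hval
    exact hβ (by linarith)
  have hlim := tendsto_limUnder_of_hasDerivAt_of_integrableOn_Ioi
    (fun r hr => hasDerivAt_half_comp_sq hm hr) hint
  have h1 := integral_Ioi_of_hasDerivAt_of_tendsto (continuousWithinAt_half_comp_sq hmc)
    (fun r hr => hasDerivAt_half_comp_sq hm hr) hint hlim
  rw [hval] at h1
  simp only [ne_eq, OfNat.ofNat_ne_zero, not_false_eq_true, zero_pow, hm0, zero_div, sub_zero] at h1
  rw [← h1] at hlim
  have h2 : Tendsto (fun s => m (√s ^ 2) / 2 * 2) atTop (𝓝 (β / 2 * 2)) :=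
    (hlim.comp tendsto_sqrt_atTop).mul_const 2
  rw [div_mul_cancel₀ _ two_ne_zero] at h2
  refine h2.congr' ?_
  filter_upwards [eventually_ge_atTop 0] with s hs
  rw [sq_sqrt hs, div_mul_cancel₀ _ two_ne_zero]

end Flux

/-- A radial `C²` solution of the Liouville-type equation, read along a ray in the variable
`s = ‖x‖ ^ 2`, is a radial flow. -/
theorem exists_isRadialFlow_of_lap_eq {a : ℝ → ℝ} {A β : ℝ} {ψ : R2 → ℝ} (ha : Continuous a)
    (hrad : RadSym ψ) (hψ : ContDiff ℝ 2 ψ)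
    (hlap : ∀ x, -lap ψ x = 4 * A * a (‖x‖ ^ 2) * exp (ψ x)) (hβ : β ≠ 0)
    (hint : ∫ x : R2, A * (a (‖x‖ ^ 2) * exp (ψ x)) = π * β) :
    ∃ U m : ℝ → ℝ, IsRadialFlow a A U m ∧ Tendsto m atTop (𝓝 β) ∧
      ∀ x, ψ x = -U (‖x‖ ^ 2) := by
  set v : R2 := EuclideanSpace.single 0 1
  have hv : ‖v‖ = 1 := by simp [v]
  set F : ℝ → ℝ := fun s => ψ (√s • v) with hF
  set m : ℝ → ℝ := fun s => -(√s / 2) * fderiv ℝ ψ (√s • v) v with hm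
  have hψF : ∀ x, ψ x = F (‖x‖ ^ 2) := fun x => hrad _ _ (by
    rw [sqrt_sq (norm_nonneg x), norm_smul, hv, mul_one, norm_norm])
  have hψ1 : ContDiff ℝ 1 (fderiv ℝ ψ) := hψ.fderiv_right (by norm_num)
  have hmc : Continuous m := by
    have h1 : Continuous fun s : ℝ => fderiv ℝ ψ (√s • v) := hψ1.continuous.comp (by fun_prop)
    fun_prop
  have hm0 : m 0 = 0 := by simp [hm]
  have hFc : Continuous F := hψ.continuous.comp (by fun_prop)
  have hray : ∀ s, 0 < s → HasDerivAt (fun s => √s • v) ((1 / (2 * √s)) • v) s := fun s hs =>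
    (hasDerivAt_sqrt hs.ne').smul_const v
  have hFd : ∀ s, 0 < s → HasDerivAt F (-m s / s) s := fun s hs => by
    have hs' : √s ≠ 0 := (sqrt_pos.2 hs).ne'
    refine ((hψ.differentiable (by norm_num) _).hasFDerivAt.comp_hasDerivAt s
      (hray s hs)).congr_deriv ?_
    rw [map_smul, smul_eq_mul, hm]
    simp only
    field_simp
    rw [sq_sqrt hs.le, mul_comm]
  have hmd : ∀ s, 0 < s → HasDerivAt m (deriv m s) s := fun s hs => by
    have h1 : DifferentiableAt ℝ (fun s : ℝ => fderiv ℝ ψ (√s • v)) s :=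
      (hψ1.differentiable (by norm_num) _).comp s (hray s hs).differentiableAt
    have h2 : DifferentiableAt ℝ (fun s : ℝ => -(√s / 2)) s :=
      ((hasDerivAt_sqrt hs.ne').differentiableAt.div_const 2).neg
    exact (h2.mul (h1.clm_apply (differentiableAt_const v))).hasDerivAt
  have hflux : ∀ s, 0 < s → HasDerivAt m (A * (a s * exp (-(-F s)))) s := fun s hs => by
    have hnorm : ‖√s • v‖ ^ 2 = s := by
      rw [norm_smul, hv, mul_one, norm_eq_abs, sq_abs, sq_sqrt hs.le]
    have hx : √s • v ≠ 0 := by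
      intro h0
      rw [h0, norm_zero, zero_pow two_ne_zero] at hnorm
      exact hs.ne hnorm
    have h1 := lap_comp_norm_sq hx hFd (f' := -((deriv m s * s - m s) / s ^ 2)) (by
      rw [hnorm]
      refine ((hmd s hs).neg.div (hasDerivAt_id s) hs.ne').congr_deriv ?_
      simp only [id, Pi.neg_apply]
      ring)
    rw [← funext hψF, hnorm] at h1
    have h2 := hlap (√s • v)
    rw [h1, hnorm] at h2
    refine (hmd s hs).congr_deriv ?_
    rw [neg_neg]
    have h3 : -(4 * (-m s / s + s * -((deriv m s * s - m s) / s ^ 2))) = 4 * deriv m s := by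
      field_simp
      ring
    rw [h3] at h2
    change deriv m s = A * (a s * exp (ψ (√s • v)))
    linarith
  refine ⟨fun s => -F s, m, ⟨fun s hs => ?_, hflux, ?_, ?_⟩, ?_, fun x => ?_⟩
  · exact (hFd s hs).neg.congr_deriv (by ring)
  · simpa [hm0] using (hmc.tendsto 0).mono_left nhdsWithin_le_nhds
  · have h1 : Continuous fun s => A * (s * a s * exp (-(-F s))) := by fun_prop
    simpa using (h1.tendsto 0).mono_left nhdsWithin_le_nhds
  · refine tendsto_flux_of_integral hflux hm0 hmc.continuousAt hβ ?_
    simpa only [hψF, neg_neg] using hint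
  · simp only [neg_neg]
    exact hψF x

lemma sphereWeight_norm_sq (l γ n : ℝ) (x : R2) : sphereWeight l γ (n / 2) (‖x‖ ^ 2) =
    ‖x‖ ^ n * ((1 + ‖x‖ ^ 2) ^ l * exp (2 * γ / (1 + ‖x‖ ^ 2))) := by
  rw [sphereWeight_of_nonneg (sq_nonneg _), ← rpow_natCast_mul (norm_nonneg x)]
  congr 2
  push_cast
  ring

theorem exists_radial_solution {n β l γ : ℝ} (hn : 0 ≤ n) (hβ : 0 < β) (hl : l < 0) (hγ : 0 ≤ γ)
    (h1 : n + 2 + 2 * l < β) (h2 : β < n + 2) :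
    ∃ ψ : R2 → ℝ, RadSym ψ ∧ ContDiff ℝ 2 ψ ∧
      (∀ x : R2, -lap ψ x =
        4 * (π * β) * sphereWeight l γ (n / 2) (‖x‖ ^ 2) * exp (ψ x)) ∧
      ∫ x : R2, sphereWeight l γ (n / 2) (‖x‖ ^ 2) * exp (ψ x) = 1 := by
  obtain ⟨A, U, hA, hU, hUeq, hlim⟩ := exists_sphere_flow (α := n / 2) (by linarith) hl hγ hβ
    (by linarith) (by linarith)
  have hac : Continuous (sphereWeight l γ (n / 2)) := continuous_sphereWeight (by linarith)
  set a := sphereWeight l γ (n / 2)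
  set e : ℝ → ℝ := fun s => A * (a s * exp (-U s)) with he
  have hec : Continuous e := by fun_prop
  have hUe : ∀ s, 0 ≤ s → ∫ σ in (0 : ℝ)..s, avg e σ = U s := fun s hs => by
    rw [hUeq s hs, ← intervalIntegral.integral_const_mul]
    simp only [avg, he, intervalIntegral.integral_const_mul]
  have hπβ : 0 < π * β := by positivity
  set ψ : R2 → ℝ := fun x => log (A / (π * β)) - ∫ σ in (0 : ℝ)..‖x‖ ^ 2, avg e σ with hψ
  have hexp : ∀ x, a (‖x‖ ^ 2) * exp (ψ x) = e (‖x‖ ^ 2) / (π * β) := fun x => by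
    simp only [hψ]
    rw [hUe _ (sq_nonneg _), sub_eq_add_neg, exp_add, exp_log (by positivity)]
    simp only [he]
    ring
  have hflux : ∀ s, HasDerivAt (fun s => A * ∫ ξ in (0 : ℝ)..s, a ξ * exp (-U ξ)) (e s) s :=
    fun s => ((by fun_prop : Continuous fun ξ => a ξ * exp (-U ξ)).integral_hasStrictDerivAt
      0 s).hasDerivAt.const_mul A
  refine ⟨ψ, fun x y hxy => ?_, contDiff_radial_potential hec _, fun x => ?_, ?_⟩
  · simp only [hψ, hxy]
  · rw [lap_radial_potential hec, mul_assoc _ (a _), hexp]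
    field_simp
  · simp only [hexp]
    rw [integral_div, integral_of_tendsto_flux (m := fun s => A * ∫ ξ in (0 : ℝ)..s,
      a ξ * exp (-U ξ)) (fun s _ => mul_nonneg hA.le (mul_nonneg (sphereWeight_nonneg s)
        (exp_pos _).le)) (fun s _ => hflux s) (by simp) (hflux 0).continuousAt hlim,
      div_self hπβ.ne']

theorem eq_of_radial_solutions {n β l γ : ℝ} (hn : 0 ≤ n) (hβ : 0 < β) (hl : l < 0) (hγ : 0 ≤ γ)
    (h1 : n + 2 + 2 * l < β) (h2 : β < n + 2) {ψ φ : R2 → ℝ} (hψr : RadSym ψ) (hφr : RadSym φ)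
    (hψc : ContDiff ℝ 2 ψ) (hφc : ContDiff ℝ 2 φ)
    (hψ : ∀ x, -lap ψ x = 4 * (π * β) * sphereWeight l γ (n / 2) (‖x‖ ^ 2) * exp (ψ x))
    (hφ : ∀ x, -lap φ x = 4 * (π * β) * sphereWeight l γ (n / 2) (‖x‖ ^ 2) * exp (φ x))
    (hψi : ∫ x : R2, sphereWeight l γ (n / 2) (‖x‖ ^ 2) * exp (ψ x) = 1)
    (hφi : ∫ x : R2, sphereWeight l γ (n / 2) (‖x‖ ^ 2) * exp (φ x) = 1) : ψ = φ := by
  have hac : Continuous (sphereWeight l γ (n / 2)) := continuous_sphereWeight (by linarith)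
  obtain ⟨U₁, m₁, hU₁, hm₁, hψU⟩ := exists_isRadialFlow_of_lap_eq hac hψr hψc hψ hβ.ne'
    (by rw [integral_const_mul, hψi, mul_one])
  obtain ⟨U₂, m₂, hU₂, hm₂, hφU⟩ := exists_isRadialFlow_of_lap_eq hac hφr hφc hφ hβ.ne'
    (by rw [integral_const_mul, hφi, mul_one])
  obtain ⟨S, hS, hN₁, hN₂⟩ := exists_sphereRate_sign_change (l := l) (γ := γ) (α := n / 2)
    (c := β / 2) (by linarith) (by linarith)
  have hU := hU₁.unique hU₂ isWeight_sphereWeight (by positivity) hβ hS hN₁ hN₂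
    (fun s hs => abs_sphereRate_le hl hγ (by linarith) hs.le) hm₁ hm₂
  refine Continuous.ext_on (dense_compl_singleton (0 : R2)) hψc.continuous hφc.continuous
    fun x hx => ?_
  have hx' : x ≠ 0 := hx
  rw [hψU, hφU, hU _ (by positivity)]

end SphericalOnsager

/-- Corollary 5.8: existence and uniqueness for the spherical Onsager equation. -/
theorem spherical_onsager (n β l γ : ℝ) (hn : 0 ≤ n) (hβ : 0 < β) (hl : l < 0)
    (hγ : 0 ≤ γ) (h1 : n + 2 + 2*l < β) (h2 : β < n + 2) :
    ∃! ψ : R2 → ℝ, RadSym ψ ∧ ContDiff ℝ 2 ψ ∧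
      (∀ x : R2, -lap ψ x = 4 * π * β * ‖x‖ ^ n *
        ((1 + ‖x‖ ^ 2) ^ l * Real.exp (2 * γ / (1 + ‖x‖ ^ 2))) * Real.exp (ψ x)) ∧
      (∫ x : R2, ‖x‖ ^ n *
        ((1 + ‖x‖ ^ 2) ^ l * Real.exp (2 * γ / (1 + ‖x‖ ^ 2))) *
          Real.exp (ψ x)) = 1 := by
  have hmul : ∀ u v w : ℝ, 4 * π * β * u * v * w = 4 * (π * β) * (u * v) * w := fun u v w => by
    ring
  simp only [hmul, ← SphericalOnsager.sphereWeight_norm_sq]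
  obtain ⟨ψ, hψr, hψc, hψ, hψi⟩ := SphericalOnsager.exists_radial_solution hn hβ hl hγ h1 h2
  exact ⟨ψ, ⟨hψr, hψc, hψ, hψi⟩, fun φ ⟨hφr, hφc, hφ, hφi⟩ =>
    SphericalOnsager.eq_of_radial_solutions hn hβ hl hγ h1 h2 hφr hψr hφc hψc hφ hψ hφi hψi⟩
end
end
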